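/- arXiv:1812.02421 — 11 statements merged into one kernel-verified Lean document; each statement's English description precedes it below -/
import Mathlib

section
/- For every t > 0 and every λ > 0, the Laplace transform of the subordination kernel φ_{1/2}(t,·) equals a Mittag-Leffler function: ∫_0^∞ (e^{-τ²/(4t)} / √(πt)) e^{-λτ} dτ = ∑_{k=0}^∞ (-λ t^{1/2})^k / Γ(k/2 + 1). -/
open Real MeasureTheory

/-- The moments of the subordination kernel of order `1/2`. -/
theorem integral_pow_mul_phi_half {t : ℝ} (ht : 0 < t) (k : ℕ) :
    ∫ τ in Set.Ioi (0 : ℝ), τ ^ k * (Real.exp (-τ ^ 2 / (4 * t)) / Real.sqrt (Real.pi * t))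
      = (t ^ (1 / 2 : ℝ)) ^ k * k.factorial / Real.Gamma ((k : ℝ) / 2 + 1) := by
  have key := integral_rpow_mul_exp_neg_mul_rpow (p := 2) (q := k) (b := (4 * t)⁻¹) two_pos
    (by have := k.cast_nonneg (α := ℝ); linarith) (by positivity)
  have hint : ∫ τ in Set.Ioi (0 : ℝ),
      τ ^ k * (Real.exp (-τ ^ 2 / (4 * t)) / Real.sqrt (Real.pi * t))
      = (∫ τ in Set.Ioi (0 : ℝ), τ ^ (k : ℝ) * Real.exp (-(4 * t)⁻¹ * τ ^ (2 : ℝ)))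
        / Real.sqrt (Real.pi * t) := by
    rw [← integral_div]
    congr 1 with τ
    rw [Real.rpow_natCast, Real.rpow_two, mul_div_assoc]
    congr 4
    field_simp
  have hdup := Real.Gamma_mul_Gamma_add_half (((k : ℝ) + 1) / 2)
  rw [show ((k : ℝ) + 1) / 2 + 1 / 2 = (k : ℝ) / 2 + 1 by ring,
    show 2 * (((k : ℝ) + 1) / 2) = (k : ℝ) + 1 by ring, Real.Gamma_nat_eq_factorial,
    show (1 : ℝ) - (k + 1) = -(k : ℝ) by ring, Real.rpow_neg zero_le_two,
    Real.rpow_natCast] at hdup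
  have hG : 0 < Real.Gamma ((k : ℝ) / 2 + 1) := Real.Gamma_pos_of_pos (by positivity)
  have hb : ((4 * t)⁻¹ : ℝ) ^ (-((k : ℝ) + 1) / 2) = (2 * Real.sqrt t) ^ (k + 1) := by
    rw [neg_div, Real.rpow_neg (by positivity), Real.inv_rpow (by positivity), inv_inv,
      show 4 * t = (2 * Real.sqrt t) ^ (2 : ℝ) by
        rw [Real.rpow_two, mul_pow, Real.sq_sqrt ht.le]; norm_num,
      ← Real.rpow_mul (by positivity), ← Real.rpow_natCast]
    congr 1
    push_cast
    ring
  have hs : 0 < Real.sqrt t := Real.sqrt_pos.2 ht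
  have hp : 0 < Real.sqrt Real.pi := Real.sqrt_pos.2 Real.pi_pos
  rw [hint, key, hb, ← Real.sqrt_eq_rpow, Real.sqrt_mul Real.pi_pos.le, eq_div_iff hG.ne',
    div_mul_eq_mul_div, mul_assoc, hdup, mul_pow]
  field_simp
  ring

/-- An exponentially weighted Gaussian is integrable. -/
theorem integrable_exp_mul_phi_half {t : ℝ} (ht : 0 < t) (l : ℝ) :
    Integrable fun τ : ℝ =>
      Real.exp (l * τ) * (Real.exp (-τ ^ 2 / (4 * t)) / Real.sqrt (Real.pi * t)) := by
  have h := ((integrable_exp_neg_mul_sq (b := (8 * t)⁻¹) (by positivity)).const_mul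
    (Real.exp (2 * l ^ 2 * t))).div_const (Real.sqrt (Real.pi * t))
  refine h.mono' (by fun_prop) (ae_of_all _ fun τ => ?_)
  rw [Real.norm_of_nonneg (by positivity), ← mul_div_assoc, ← Real.exp_add, ← Real.exp_add]
  refine div_le_div_of_nonneg_right (Real.exp_le_exp.2 ?_) (Real.sqrt_nonneg _)
  have : 2 * l ^ 2 * t + -(8 * t)⁻¹ * τ ^ 2 - (l * τ + -τ ^ 2 / (4 * t))
      = (4 * l * t - τ) ^ 2 / (8 * t) := by
    field_simp
    ring
  have : 0 ≤ (4 * l * t - τ) ^ 2 / (8 * t) := by positivity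
  linarith

/-- For every `t > 0` and `λ > 0`, the Laplace transform of the subordination kernel
`φ_{1/2}(t,τ) = e^{-τ²/(4t)} / √(πt)` equals the Mittag-Leffler function `E_{1/2}(-λ√t)`. -/
theorem laplace_phi_half (t l : ℝ) (ht : 0 < t) (hl : 0 < l) :
    ∫ τ in Set.Ioi (0 : ℝ),
      (Real.exp (-τ ^ 2 / (4 * t)) / Real.sqrt (Real.pi * t)) * Real.exp (-l * τ)
      = ∑' k : ℕ, (-(l * t ^ (1 / 2 : ℝ))) ^ k / Real.Gamma ((k : ℝ) / 2 + 1) := by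
  have hexp (x : ℝ) : HasSum (fun n : ℕ => x ^ n / n.factorial) (Real.exp x) := by
    rw [Real.exp_eq_exp_ℝ]
    exact NormedSpace.expSeries_div_hasSum_exp x
  let g : ℝ → ℝ := fun τ => Real.exp (-τ ^ 2 / (4 * t)) / Real.sqrt (Real.pi * t)
  have hsum := hasSum_integral_of_dominated_convergence (μ := volume.restrict (Set.Ioi (0 : ℝ)))
    (F := fun (n : ℕ) τ => (-l * τ) ^ n / n.factorial * g τ)
    (f := fun τ => Real.exp (-l * τ) * g τ)
    (fun n τ => (l * τ) ^ n / n.factorial * g τ)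
    (fun n => by fun_prop)
    (fun n => by
      filter_upwards [ae_restrict_mem measurableSet_Ioi] with τ hτ
      have hτ : 0 < τ := hτ
      have hgτ : 0 ≤ g τ := by positivity
      simp [abs_of_pos hl, abs_of_pos hτ, abs_of_nonneg hgτ])
    (ae_of_all _ fun τ => ((hexp (l * τ)).mul_right (g τ)).summable)
    (by
      simp_rw [fun τ => ((hexp (l * τ)).mul_right (g τ)).tsum_eq]
      exact (integrable_exp_mul_phi_half ht l).integrableOn)
    (ae_of_all _ fun τ => (hexp (-l * τ)).mul_right (g τ))
  refine (integral_congr_ae (ae_of_all _ fun τ => mul_comm _ _)).trans (hsum.tsum_eq.symm.trans ?_)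
  congr 1 with k
  have : ∀ τ, (-l * τ) ^ k / k.factorial * g τ = (-l) ^ k / k.factorial * (τ ^ k * g τ) := by
    intro τ
    rw [mul_pow]
    ring
  simp_rw [this]
  rw [integral_const_mul, integral_pow_mul_phi_half ht, ← neg_mul, mul_pow]
  field_simp
end

section
/- For all t > 0 and τ > 0, the composition of the time-fractional kernel with the space-fractional kernel is given by ∫_0^∞ φ_{1/2}(t,σ) f_{1/2}(σ,τ) dσ = √t / (π √τ (t + τ)), i.e. ∫_0^∞ (e^{-σ²/(4t)} / √(πt)) · (σ e^{-σ²/(4τ)} / (2√π τ^{3/2})) dσ = √t / (π √τ (t + τ)). -/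
open Real MeasureTheory

theorem integral_mul_exp_neg_mul_sq_Ioi {b : ℝ} (hb : 0 < b) :
    ∫ x in Set.Ioi (0 : ℝ), x * Real.exp (-b * x ^ 2) = (2 * b)⁻¹ := by
  have h := integral_mul_cexp_neg_mul_sq (b := (b : ℂ)) (by simpa using hb)
  have h' : ((∫ x in Set.Ioi (0 : ℝ), x * Real.exp (-b * x ^ 2) : ℝ) : ℂ) =
      (((2 * b)⁻¹ : ℝ) : ℂ) := by
    rw [← integral_complex_ofReal]
    push_cast
    exact h
  exact_mod_cast h'

theorem Real.rpow_three_halves {x : ℝ} (hx : 0 < x) : x ^ (3 / 2 : ℝ) = x * √x := by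
  rw [show (3 / 2 : ℝ) = 1 + 1 / 2 by norm_num, rpow_add hx, rpow_one, ← sqrt_eq_rpow]

/-- For all `t > 0` and `τ > 0`:
`∫_0^∞ φ_{1/2}(t,σ) f_{1/2}(σ,τ) dσ = √t / (π √τ (t + τ))`. -/
theorem phi_comp_f_half (t τ : ℝ) (ht : 0 < t) (hτ : 0 < τ) :
    ∫ σ in Set.Ioi (0 : ℝ),
      (Real.exp (-σ ^ 2 / (4 * t)) / Real.sqrt (Real.pi * t)) *
        (σ * Real.exp (-σ ^ 2 / (4 * τ)) / (2 * Real.sqrt Real.pi * τ ^ (3 / 2 : ℝ)))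
      = Real.sqrt t / (Real.pi * Real.sqrt τ * (t + τ)) := by
  have integrand_eq (σ : ℝ) :
      (Real.exp (-σ ^ 2 / (4 * t)) / √(π * t)) *
        (σ * Real.exp (-σ ^ 2 / (4 * τ)) / (2 * √π * τ ^ (3 / 2 : ℝ))) =
      (√π * √t * (2 * √π * (τ * √τ)))⁻¹ *
        (σ * Real.exp (-((t + τ) / (4 * t * τ)) * σ ^ 2)) := by
    have exponent_eq : -((t + τ) / (4 * t * τ)) * σ ^ 2 =
        -σ ^ 2 / (4 * t) + -σ ^ 2 / (4 * τ) := by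
      field_simp
      ring
    rw [exponent_eq, Real.exp_add, Real.rpow_three_halves hτ, Real.sqrt_mul pi_pos.le]
    have := pi_pos
    field_simp
  simp_rw [integrand_eq]
  rw [integral_const_mul, integral_mul_exp_neg_mul_sq_Ioi (by positivity)]
  have hπ := pi_pos
  have hst : 0 < √t := sqrt_pos.2 ht
  have hsτ : 0 < √τ := sqrt_pos.2 hτ
  have hsπ : 0 < √π := sqrt_pos.2 hπ
  field_simp
  rw [Real.sq_sqrt ht.le, Real.sq_sqrt hπ.le]
  ring
end

section
/- For all t > 0 and τ > 0, the composition in the opposite order gives a different result: ∫_0^∞ f_{1/2}(t,σ) φ_{1/2}(σ,τ) dσ = 2t / (π (t² + τ²)), i.e. ∫_0^∞ (t e^{-t²/(4σ)} / (2√π σ^{3/2})) · (e^{-τ²/(4σ)} / √(πσ)) dσ = 2t / (π (t² + τ²)). -/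
open Real MeasureTheory

/-- For all `t > 0` and `τ > 0`:
`∫_0^∞ f_{1/2}(t,σ) φ_{1/2}(σ,τ) dσ = 2t / (π (t² + τ²))`. -/
theorem f_comp_phi_half (t τ : ℝ) (ht : 0 < t) (hτ : 0 < τ) :
    ∫ σ in Set.Ioi (0 : ℝ),
      (t * Real.exp (-t ^ 2 / (4 * σ)) / (2 * Real.sqrt Real.pi * σ ^ (3 / 2 : ℝ))) *
        (Real.exp (-τ ^ 2 / (4 * σ)) / Real.sqrt (Real.pi * σ))
      = 2 * t / (Real.pi * (t ^ 2 + τ ^ 2)) := by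
  have hc : -((t ^ 2 + τ ^ 2) / 4) < 0 := neg_lt_zero.mpr (by positivity)
  calc
    _ = ∫ σ in Set.Ioi (0 : ℝ), (|(-1 : ℝ)| * σ ^ ((-1 : ℝ) - 1)) •
          (t / (2 * π) * Real.exp (-((t ^ 2 + τ ^ 2) / 4) * σ ^ (-1 : ℝ))) := by
      refine setIntegral_congr_fun measurableSet_Ioi fun σ hσ => ?_
      have hσ : 0 < σ := hσ
      have hexp : Real.exp (-((t ^ 2 + τ ^ 2) / 4) * σ ^ (-1 : ℝ)) =
          Real.exp (-t ^ 2 / (4 * σ)) * Real.exp (-τ ^ 2 / (4 * σ)) := by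
        rw [← Real.exp_add, Real.rpow_neg_one]
        congr 1
        field_simp
        ring
      have hpow : σ ^ (3 / 2 : ℝ) = σ * √σ := by
        rw [Real.sqrt_eq_rpow, ← Real.rpow_one_add' hσ.le (by norm_num)]
        norm_num
      have hinv : σ ^ ((-1 : ℝ) - 1) = (σ ^ 2)⁻¹ := by
        rw [← Real.rpow_natCast, ← Real.rpow_neg hσ.le]
        norm_num
      have hden : 2 * √π * (σ * √σ) * (√π * √σ) = 2 * π * σ ^ 2 := by
        linear_combination 2 * σ * √σ ^ 2 * Real.sq_sqrt Real.pi_pos.le +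
          2 * σ * π * Real.sq_sqrt hσ.le
      simp only [hexp, hpow, hinv, Real.sqrt_mul Real.pi_pos.le, div_mul_div_comm, hden,
        smul_eq_mul, abs_neg, abs_one, one_mul]
      field_simp
    _ = ∫ x in Set.Ioi (0 : ℝ),
          t / (2 * π) * Real.exp (-((t ^ 2 + τ ^ 2) / 4) * x) :=
      integral_comp_rpow_Ioi (fun x => t / (2 * π) * Real.exp (-((t ^ 2 + τ ^ 2) / 4) * x))
        (by norm_num)
    _ = 2 * t / (Real.pi * (t ^ 2 + τ ^ 2)) := by
      rw [integral_const_mul, integral_exp_mul_Ioi hc]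
      simp only [mul_zero, Real.exp_zero]
      field_simp
      norm_num
end

section
/- Let 0 < α ≤ 1 and 0 < β ≤ 1. The function g(λ) = E_β(-λ^α) = ∑_{k=0}^∞ (-λ^α)^k / Γ(βk + 1) is completely monotone on (0,∞); that is, g is infinitely differentiable on (0,∞) and (-1)^n g^{(n)}(λ) ≥ 0 for every λ > 0 and every natural number n. -/
open Real Set Filter Topology

/-- `CompletelyMonotoneUpTo c n f` says that the first `n` derivatives of `f` exist on `(c, ∞)` and
that the derivatives of order at most `n` have alternating signs there. -/
def CompletelyMonotoneUpTo (c : ℝ) : ℕ → (ℝ → ℝ) → Prop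
  | 0, f => ∀ x, c < x → 0 ≤ f x
  | n + 1, f => (∀ x, c < x → 0 ≤ f x) ∧
      ∃ g, (∀ x, c < x → HasDerivAt f (-(g x)) x) ∧ CompletelyMonotoneUpTo c n g

namespace CompletelyMonotoneUpTo

variable {c : ℝ} {n : ℕ} {f g : ℝ → ℝ}

lemma of_succ (hf : CompletelyMonotoneUpTo c (n + 1) f) : CompletelyMonotoneUpTo c n f := by
  induction n generalizing f with
  | zero => exact hf.1
  | succ n ih =>
    obtain ⟨h0, g, hg, hgn⟩ := hf
    exact ⟨h0, g, hg, ih hgn⟩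

lemma mono_left {c' : ℝ} (hf : CompletelyMonotoneUpTo c n f) (hc : c ≤ c') :
    CompletelyMonotoneUpTo c' n f := by
  induction n generalizing f with
  | zero => exact fun x hx => hf x (hc.trans_lt hx)
  | succ n ih =>
    obtain ⟨h0, g, hg, hgn⟩ := hf
    exact ⟨fun x hx => h0 x (hc.trans_lt hx), g, fun x hx => hg x (hc.trans_lt hx), ih hgn⟩

lemma add (hf : CompletelyMonotoneUpTo c n f) (hg : CompletelyMonotoneUpTo c n g) :
    CompletelyMonotoneUpTo c n (fun x => f x + g x) := by
  induction n generalizing f g with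
  | zero => exact fun x hx => add_nonneg (hf x hx) (hg x hx)
  | succ n ih =>
    obtain ⟨hf0, f', hf', hfn⟩ := hf
    obtain ⟨hg0, g', hg', hgn⟩ := hg
    refine ⟨fun x hx => add_nonneg (hf0 x hx) (hg0 x hx), fun x => f' x + g' x,
      fun x hx => ?_, ih hfn hgn⟩
    exact ((hf' x hx).add (hg' x hx)).congr_deriv (by ring)

lemma mul (hf : CompletelyMonotoneUpTo c n f) (hg : CompletelyMonotoneUpTo c n g) :
    CompletelyMonotoneUpTo c n (fun x => f x * g x) := by
  induction n generalizing f g with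
  | zero => exact fun x hx => mul_nonneg (hf x hx) (hg x hx)
  | succ n ih =>
    have hfs := hf.of_succ
    have hgs := hg.of_succ
    obtain ⟨hf0, f', hf', hfn⟩ := hf
    obtain ⟨hg0, g', hg', hgn⟩ := hg
    refine ⟨fun x hx => mul_nonneg (hf0 x hx) (hg0 x hx), fun x => f' x * g x + f x * g' x,
      fun x hx => ?_, (ih hfn hgs).add (ih hfs hgn)⟩
    exact ((hf' x hx).mul (hg' x hx)).congr_deriv (by ring)

/-- A completely monotone function composed with a positive function whose derivative is
completely monotone is completely monotone. -/
lemma comp {φ φ' : ℝ → ℝ} {d : ℝ} (hf : CompletelyMonotoneUpTo d n f)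
    (hφ0 : ∀ x, c < x → d < φ x) (hφ : ∀ x, c < x → HasDerivAt φ (φ' x) x)
    (hφ' : CompletelyMonotoneUpTo c n φ') :
    CompletelyMonotoneUpTo c n (fun x => f (φ x)) := by
  induction n generalizing f with
  | zero => exact fun x hx => hf _ (hφ0 x hx)
  | succ n ih =>
    obtain ⟨hf0, f', hf', hfn⟩ := hf
    refine ⟨fun x hx => hf0 _ (hφ0 x hx), fun x => f' (φ x) * φ' x, fun x hx => ?_,
      (ih hfn hφ'.of_succ).mul hφ'.of_succ⟩
    exact ((hf' _ (hφ0 x hx)).comp x (hφ x hx)).congr_deriv (by ring)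

lemma of_seq {D : ℕ → ℝ → ℝ} (h0 : ∀ n x, c < x → 0 ≤ D n x)
    (hD : ∀ n x, c < x → HasDerivAt (D n) (-(D (n + 1) x)) x) (n m : ℕ) :
    CompletelyMonotoneUpTo c n (D m) := by
  induction n generalizing m with
  | zero => exact h0 m
  | succ n ih => exact ⟨h0 m, D (m + 1), hD m, ih (m + 1)⟩

lemma congr (hf : CompletelyMonotoneUpTo c n f) (hfg : ∀ x, c < x → g x = f x) :
    CompletelyMonotoneUpTo c n g := by
  cases n with
  | zero => exact fun x hx => hfg x hx ▸ hf x hx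
  | succ n =>
    obtain ⟨hf0, f', hf', hfn⟩ := hf
    refine ⟨fun x hx => hfg x hx ▸ hf0 x hx, f', fun x hx => ?_, hfn⟩
    refine (hf' x hx).congr_of_eventuallyEq ?_
    filter_upwards [Ioi_mem_nhds hx] with y hy using hfg y hy

lemma seq_nonneg {D : ℕ → ℝ → ℝ} {m : ℕ} (hf : CompletelyMonotoneUpTo c n (D m))
    (hD : ∀ n x, c < x → HasDerivAt (D n) (-(D (n + 1) x)) x) {x : ℝ} (hx : c < x) :
    0 ≤ D (m + n) x := by
  induction n generalizing m with
  | zero => exact hf x hx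
  | succ n ih =>
    obtain ⟨-, g, hg, hgn⟩ := hf
    have := ih (m := m + 1)
      (hgn.congr fun y hy => neg_injective ((hD m y hy).unique (hg y hy)))
    rwa [add_right_comm] at this

lemma iteratedDerivWithin_nonneg (hf : CompletelyMonotoneUpTo c n f) {x : ℝ} (hx : c < x) :
    0 ≤ (-1 : ℝ) ^ n * iteratedDerivWithin n f (Ioi c) x := by
  induction n generalizing f with
  | zero => simpa using hf x hx
  | succ n ih =>
    obtain ⟨-, g, hg, hgn⟩ := hf
    have h : EqOn (derivWithin f (Ioi c)) (-g) (Ioi c) := fun y hy =>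
      (hg y hy).hasDerivWithinAt.derivWithin (isOpen_Ioi.uniqueDiffWithinAt hy)
    rw [iteratedDerivWithin_succ', iteratedDerivWithin_congr h hx, iteratedDerivWithin_neg]
    have := ih hgn
    rw [pow_succ]
    linarith

lemma contDiffOn (hf : CompletelyMonotoneUpTo c (n + 1) f) : ContDiffOn ℝ n f (Ioi c) := by
  induction n generalizing f with
  | zero =>
    obtain ⟨-, g, hg, -⟩ := hf
    rw [Nat.cast_zero, contDiffOn_zero]
    exact fun x hx => (hg x hx).continuousAt.continuousWithinAt
  | succ n ih =>
    obtain ⟨-, g, hg, hgn⟩ := hf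
    rw [Nat.cast_succ, contDiffOn_succ_iff_deriv_of_isOpen isOpen_Ioi]
    refine ⟨fun x hx => (hg x hx).differentiableAt.differentiableWithinAt, by simp, ?_⟩
    exact (ih hgn).neg.congr fun x hx => (hg x hx).deriv

end CompletelyMonotoneUpTo

lemma hasDerivAt_rpow_neg (r : ℝ) {x : ℝ} (hx : 0 < x) :
    HasDerivAt (fun y : ℝ => y ^ (-r)) (-(r * x ^ (-(r + 1)))) x := by
  refine (hasDerivAt_rpow_const (p := -r) (Or.inl hx.ne')).congr_deriv ?_
  rw [show -(r + 1) = -r - 1 by ring]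
  ring

lemma completelyMonotoneUpTo_const_mul_rpow_neg (n : ℕ) {a r : ℝ} (ha : 0 ≤ a) (hr : 0 ≤ r) :
    CompletelyMonotoneUpTo 0 n (fun x => a * x ^ (-r)) := by
  induction n generalizing a r with
  | zero => exact fun x hx => by positivity
  | succ n ih =>
    refine ⟨fun x hx => by positivity, fun x => (a * r) * x ^ (-(r + 1)), fun x hx => ?_,
      ih (by positivity) (by positivity)⟩
    exact ((hasDerivAt_rpow_neg r hx).const_mul a).congr_deriv (by ring)

lemma completelyMonotoneUpTo_const_mul_rpow_sub_one (n : ℕ) {a r : ℝ} (ha : 0 ≤ a) (hr : r ≤ 1) :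
    CompletelyMonotoneUpTo 0 n (fun x => a * x ^ (r - 1)) := by
  have := completelyMonotoneUpTo_const_mul_rpow_neg n ha (sub_nonneg.2 hr)
  rwa [neg_sub] at this

lemma completelyMonotoneUpTo_resolvent (n j : ℕ) {β l : ℝ} (hβ0 : 0 < β) (hβ1 : β ≤ 1)
    (hl : 0 < l) :
    CompletelyMonotoneUpTo 0 n
      (fun s => (j.factorial * s ^ (β - 1)) * (s ^ β + l) ^ (-(j + 1 : ℝ))) := by
  refine (completelyMonotoneUpTo_const_mul_rpow_sub_one n (by positivity) hβ1).mul ?_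
  have h := completelyMonotoneUpTo_const_mul_rpow_neg n zero_le_one
    (show (0 : ℝ) ≤ j + 1 by positivity)
  simp only [one_mul] at h
  refine h.comp (φ := fun s => s ^ β + l) (φ' := fun s => β * s ^ (β - 1))
    (fun x hx => by positivity) (fun x hx => ?_)
    (completelyMonotoneUpTo_const_mul_rpow_sub_one n hβ0.le hβ1)
  exact (hasDerivAt_rpow_const (Or.inl hx.ne')).add_const l

/-- The weight `(a + 1) ⋯ (a + n) / (n! n ^ a)`, which tends to `1 / Γ(a + 1)`. -/
noncomputable def gammaWeight (n : ℕ) (a : ℝ) : ℝ :=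
  (∏ i ∈ Finset.range n, (a + 1 + i)) / n.factorial * (n : ℝ) ^ (-a)

lemma gammaWeight_nonneg (n : ℕ) {a : ℝ} (ha : 0 ≤ a) : 0 ≤ gammaWeight n a := by
  unfold gammaWeight
  have : 0 ≤ ∏ i ∈ Finset.range n, (a + 1 + i) := Finset.prod_nonneg fun i _ => by positivity
  positivity

lemma gammaWeight_succ_le {n : ℕ} (hn : 1 ≤ n) {a : ℝ} (ha : 0 ≤ a) :
    gammaWeight (n + 1) a ≤ gammaWeight n a := by
  have hn' : (0 : ℝ) < n := by exact_mod_cast hn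
  have hP : 0 ≤ ∏ i ∈ Finset.range n, (a + 1 + i) := Finset.prod_nonneg fun i _ => by positivity
  have key : (a + 1 + n) / (n + 1) * ((n + 1 : ℕ) : ℝ) ^ (-a) ≤ (n : ℝ) ^ (-a) := by
    have h1 : (a + 1 + n) / (n + 1) ≤ exp (a / (n + 1)) := by
      have := add_one_le_exp (a / (n + 1 : ℝ))
      convert this using 1
      field_simp
      ring
    have h2 : log n - log (n + 1) ≤ -(1 / (n + 1)) := by
      rw [← log_div hn'.ne' (by positivity)]
      have := log_le_sub_one_of_pos (show (0 : ℝ) < n / (n + 1) by positivity)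
      convert this using 1
      field_simp
      ring
    push_cast
    rw [rpow_def_of_pos hn', rpow_def_of_pos (by positivity)]
    calc _ ≤ exp (a / (n + 1)) * exp (log (n + 1) * -a) := by gcongr
      _ = exp (a / (n + 1) + log (n + 1) * -a) := (exp_add _ _).symm
      _ ≤ exp (log n * -a) := by
        apply exp_le_exp.2
        have := mul_le_mul_of_nonneg_left h2 ha
        have e : a * -(1 / ((n : ℝ) + 1)) = -(a / (n + 1)) := by ring
        rw [e] at this
        linarith
  calc gammaWeight (n + 1) a
      = (∏ i ∈ Finset.range n, (a + 1 + i)) / n.factorial *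
        ((a + 1 + n) / (n + 1) * ((n + 1 : ℕ) : ℝ) ^ (-a)) := by
        unfold gammaWeight
        rw [Finset.prod_range_succ, Nat.factorial_succ]
        push_cast
        field_simp
    _ ≤ gammaWeight n a := by
        unfold gammaWeight
        gcongr

lemma gammaWeight_le_of_le {p n : ℕ} (hp : 1 ≤ p) (hpn : p ≤ n) {a : ℝ} (ha : 0 ≤ a) :
    gammaWeight n a ≤ gammaWeight p a := by
  induction n, hpn using Nat.le_induction with
  | base => exact le_rfl
  | succ n hn ih => exact (gammaWeight_succ_le (hp.trans hn) ha).trans ih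

lemma tendsto_gammaWeight {a : ℝ} (ha : 0 ≤ a) :
    Tendsto (fun n => gammaWeight n a) atTop (𝓝 (Gamma (a + 1))⁻¹) := by
  have h1 := (GammaSeq_tendsto_Gamma (a + 1)).inv₀ (Gamma_pos_of_pos (by positivity)).ne'
  have h2 := tendsto_natCast_div_add_atTop (𝕜 := ℝ) (a + 1)
  have h3 := h1.mul h2
  rw [mul_one] at h3
  refine h3.congr' ?_
  filter_upwards [eventually_ge_atTop 1] with n hn
  have hn' : (0 : ℝ) < n := by exact_mod_cast hn
  have hP : 0 < ∏ i ∈ Finset.range n, (a + 1 + i) := Finset.prod_pos fun i _ => by positivity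
  rw [GammaSeq, gammaWeight, Finset.prod_range_succ, rpow_add hn', rpow_one, rpow_neg hn'.le]
  have : 0 < a + 1 + n := by positivity
  field_simp
  ring

lemma prod_range_add_le {n : ℕ} {a b : ℝ} (ha : 0 ≤ a) (hab : a ≤ b) :
    ∏ i ∈ Finset.range n, (a + 1 + i) ≤ (b + n) ^ n := by
  calc ∏ i ∈ Finset.range n, (a + 1 + i) ≤ ∏ i ∈ Finset.range n, (b + n) := by
        refine Finset.prod_le_prod (fun i _ => by positivity) fun i hi => ?_
        have : ((i + 1 : ℕ) : ℝ) ≤ n := by exact_mod_cast Finset.mem_range.1 hi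
        push_cast at this
        linarith
    _ = (b + n) ^ n := by simp

lemma gammaWeight_mul_le {p k : ℕ} {β : ℝ} (hβ0 : 0 < β) (hβ1 : β ≤ 1) :
    gammaWeight p (β * k) ≤ (k + p : ℝ) ^ p * ((p : ℝ) ^ (-β)) ^ k := by
  unfold gammaWeight
  rw [← rpow_natCast ((p : ℝ) ^ (-β)), ← rpow_mul p.cast_nonneg, neg_mul]
  gcongr
  have h1 : β * k ≤ k := mul_le_of_le_one_left k.cast_nonneg hβ1
  refine (div_le_self (Finset.prod_nonneg fun i _ => by positivity) ?_).trans
    (prod_range_add_le (by positivity) h1)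
  exact_mod_cast p.factorial_pos

lemma summable_add_pow_mul_geometric (N M : ℕ) {q : ℝ} (hq0 : 0 < q) (hq1 : q < 1) :
    Summable fun k : ℕ => (k + N : ℝ) ^ M * q ^ k := by
  have h := (summable_nat_add_iff N).2 (summable_pow_mul_geometric_of_norm_lt_one M
    (r := q) (by rwa [norm_of_nonneg hq0.le]))
  refine (h.mul_right (q ^ N)⁻¹).congr fun k => ?_
  rw [pow_add]
  push_cast
  field_simp

lemma exists_nat_lt_rpow {β : ℝ} (hβ0 : 0 < β) (R : ℝ) : ∃ p : ℕ, 1 ≤ p ∧ R < (p : ℝ) ^ β := by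
  have h := (tendsto_rpow_atTop hβ0).comp (tendsto_natCast_atTop_atTop (R := ℝ))
  obtain ⟨p, hp, hp1⟩ := ((h.eventually_gt_atTop R).and (eventually_ge_atTop 1)).exists
  exact ⟨p, hp1, hp⟩

lemma mul_rpow_neg_lt_one {β R : ℝ} {p : ℕ} (hp : 1 ≤ p) (hR : R < (p : ℝ) ^ β) :
    R * (p : ℝ) ^ (-β) < 1 := by
  have hp' : (0 : ℝ) < p := by exact_mod_cast hp
  rw [rpow_neg hp'.le, ← div_eq_mul_inv, div_lt_one (by positivity)]
  exact hR

lemma summable_pow_mul_gammaWeight {β R : ℝ} {p : ℕ} (hβ0 : 0 < β) (hβ1 : β ≤ 1) (hp : 1 ≤ p)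
    (hR0 : 0 < R) (hR : R < (p : ℝ) ^ β) (j : ℕ) :
    Summable fun k : ℕ => (k : ℝ) ^ j * R ^ k * gammaWeight p (β * k) := by
  have hp' : (0 : ℝ) < p := by exact_mod_cast hp
  refine .of_nonneg_of_le (fun k => ?_) (fun k => ?_)
    (summable_add_pow_mul_geometric p (j + p) (q := R * (p : ℝ) ^ (-β)) (by positivity)
      (mul_rpow_neg_lt_one hp hR))
  · have := gammaWeight_nonneg p (a := β * k) (by positivity)
    positivity
  · calc (k : ℝ) ^ j * R ^ k * gammaWeight p (β * k)
        ≤ (k + p : ℝ) ^ j * R ^ k * ((k + p : ℝ) ^ p * ((p : ℝ) ^ (-β)) ^ k) := by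
          gcongr
          · exact gammaWeight_nonneg p (by positivity)
          · exact le_add_of_nonneg_right p.cast_nonneg
          · exact gammaWeight_mul_le hβ0 hβ1
      _ = _ := by rw [mul_pow, pow_add]; ring

lemma inv_Gamma_le_gammaWeight {p : ℕ} (hp : 1 ≤ p) {a : ℝ} (ha : 0 ≤ a) :
    (Gamma (a + 1))⁻¹ ≤ gammaWeight p a :=
  le_of_tendsto (tendsto_gammaWeight ha) <| by
    filter_upwards [eventually_ge_atTop p] with n hn using gammaWeight_le_of_le hp hn ha

lemma summable_pow_mul_inv_Gamma {β R : ℝ} (hβ0 : 0 < β) (hβ1 : β ≤ 1) (hR0 : 0 < R) (j : ℕ) :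
    Summable fun k : ℕ => (k : ℝ) ^ j * R ^ k * (Gamma (β * k + 1))⁻¹ := by
  obtain ⟨p, hp, hR⟩ := exists_nat_lt_rpow hβ0 R
  refine .of_nonneg_of_le (fun k => ?_) (fun k => ?_)
    (summable_pow_mul_gammaWeight hβ0 hβ1 hp hR0 hR j)
  · have := Gamma_pos_of_pos (show 0 < β * k + 1 by positivity)
    positivity
  · gcongr
    exact inv_Gamma_le_gammaWeight hp (by positivity)

/-- The `j`-th derivative of `x ↦ x ^ k`, evaluated at `-x`. -/
noncomputable def powDeriv (j k : ℕ) (x : ℝ) : ℝ := k.descFactorial j * (-x) ^ (k - j)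

lemma hasDerivAt_powDeriv (j k : ℕ) (x : ℝ) :
    HasDerivAt (powDeriv j k) (-(powDeriv (j + 1) k x)) x := by
  unfold powDeriv
  refine (((hasDerivAt_id x).neg.pow (k - j)).const_mul (k.descFactorial j : ℝ)).congr_deriv ?_
  rw [Nat.descFactorial_succ, Nat.sub_sub]
  push_cast
  simp only [id, Pi.neg_apply]
  ring

lemma abs_powDeriv_le {j k : ℕ} {x R : ℝ} (hR : 1 ≤ R) (hx : |x| ≤ R) :
    |powDeriv j k x| ≤ (k : ℝ) ^ j * R ^ k := by
  unfold powDeriv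
  rw [abs_mul, abs_pow, abs_neg, Nat.abs_cast]
  have h1 : (k.descFactorial j : ℝ) ≤ (k : ℝ) ^ j := by
    exact_mod_cast Nat.descFactorial_le_pow k j
  have h2 : |x| ^ (k - j) ≤ R ^ k :=
    (pow_le_pow_left₀ (abs_nonneg x) hx _).trans (pow_le_pow_right₀ hR (Nat.sub_le k j))
  gcongr

lemma hasSum_powDeriv_mul_pow (j : ℕ) {l q : ℝ} (h : |l * q| < 1) :
    HasSum (fun k => powDeriv j k l * q ^ k) (j.factorial * q ^ j / (1 + l * q) ^ (j + 1)) := by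
  have h1 := (hasSum_choose_mul_geometric_of_norm_lt_one j (r := -(l * q))
    (by rwa [norm_neg])).mul_left (j.factorial * q ^ j)
  rw [← (add_left_injective j).hasSum_iff (fun k hk => ?_)]
  · have hterm : (fun k => powDeriv j k l * q ^ k) ∘ (fun k => k + j) =
        fun k => j.factorial * q ^ j * ((k + j).choose j * (-(l * q)) ^ k) := by
      ext k
      simp only [Function.comp_apply, powDeriv, Nat.descFactorial_eq_factorial_mul_choose,
        Nat.add_sub_cancel, pow_add]
      rw [← neg_mul, mul_pow]
      push_cast
      ring
    rw [hterm]
    rwa [sub_neg_eq_add, mul_one_div] at h1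
  · have : k < j := by
      by_contra! hkj
      exact hk ⟨k - j, Nat.sub_add_cancel hkj⟩
    simp [powDeriv, Nat.descFactorial_of_lt this]

/-- Up to sign, the `n`-th derivative of the series `∑ k, powDeriv j k l * s ^ (-(β * k + 1))`. -/
noncomputable def resolventDeriv (β l : ℝ) (j n : ℕ) (s : ℝ) : ℝ :=
  ∑' k : ℕ, powDeriv j k l * (∏ i ∈ Finset.range n, (β * k + 1 + i)) * s ^ (-(β * k + 1 + n))

lemma resolventDeriv_zero {β l : ℝ} (j : ℕ) {s : ℝ} (hs : 0 < s) (hl : 0 < l) (h : l < s ^ β) :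
    resolventDeriv β l j 0 s =
      (j.factorial * s ^ (β - 1)) * (s ^ β + l) ^ (-(j + 1 : ℝ)) := by
  have hsβ : 0 < s ^ β := by positivity
  have hq : |l * (s ^ β)⁻¹| < 1 := by
    rw [abs_of_pos (by positivity), ← div_eq_mul_inv, div_lt_one hsβ]
    exact h
  have h1 := (hasSum_powDeriv_mul_pow j hq).mul_right s⁻¹
  have h2 : resolventDeriv β l j 0 s = ∑' k, powDeriv j k l * (s ^ β)⁻¹ ^ k * s⁻¹ := by
    unfold resolventDeriv
    refine tsum_congr fun k => ?_
    rw [Nat.cast_zero, add_zero, rpow_neg hs.le, rpow_add hs, rpow_one, rpow_mul hs.le,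
      rpow_natCast, mul_inv, inv_pow]
    simp
    ring
  rw [h2, h1.tsum_eq, show (-(j + 1 : ℝ)) = -((j + 1 : ℕ) : ℝ) by push_cast; ring,
    rpow_neg (by positivity), rpow_natCast, rpow_sub_one hs.ne',
    show 1 + l * (s ^ β)⁻¹ = (s ^ β + l) / s ^ β by field_simp,
    div_pow, inv_pow]
  field_simp
  ring

lemma hasDerivAt_resolventDeriv {β l : ℝ} {p : ℕ} (hβ0 : 0 < β) (hβ1 : β ≤ 1) (hp : 1 ≤ p)
    (hlp : max 1 |l| < (p : ℝ) ^ β) (j n : ℕ) {s : ℝ} (hs : (p : ℝ) < s) :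
    HasDerivAt (resolventDeriv β l j n) (-(resolventDeriv β l j (n + 1) s)) s := by
  have hp' : (0 : ℝ) < p := by exact_mod_cast hp
  have hp1 : (1 : ℝ) ≤ p := by exact_mod_cast hp
  set R := max 1 |l|
  have hR0 : 0 < R := lt_max_of_lt_left one_pos
  have bound : ∀ (m k : ℕ) (y : ℝ), (p : ℝ) < y →
      ‖powDeriv j k l * (∏ i ∈ Finset.range m, (β * k + 1 + i)) * y ^ (-(β * k + 1 + m))‖ ≤
        (k + m : ℝ) ^ (j + m) * (R * (p : ℝ) ^ (-β)) ^ k := fun m k y hy => by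
    have hP : 0 ≤ ∏ i ∈ Finset.range m, (β * k + 1 + i) :=
      Finset.prod_nonneg fun i _ => by positivity
    have hy0 : 0 < y := hp'.trans hy
    have h3 : y ^ (-(β * k + 1 + m)) ≤ ((p : ℝ) ^ (-β)) ^ k := by
      rw [← rpow_natCast ((p : ℝ) ^ (-β)), ← rpow_mul hp'.le]
      calc y ^ (-(β * k + 1 + m)) ≤ (p : ℝ) ^ (-(β * k + 1 + m)) :=
            rpow_le_rpow_of_nonpos hp' hy.le (by rw [neg_nonpos]; positivity)
        _ ≤ (p : ℝ) ^ (-β * k) := by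
            apply rpow_le_rpow_of_exponent_le hp1
            have : (0 : ℝ) ≤ m := m.cast_nonneg
            linarith
    rw [norm_mul, norm_mul, norm_of_nonneg hP, norm_of_nonneg (rpow_nonneg hy0.le _), norm_eq_abs]
    calc _ ≤ ((k : ℝ) ^ j * R ^ k) * (k + m : ℝ) ^ m * ((p : ℝ) ^ (-β)) ^ k := by
          gcongr
          · exact abs_powDeriv_le (le_max_left _ _) (le_max_right _ _)
          · exact prod_range_add_le (by positivity) (mul_le_of_le_one_left k.cast_nonneg hβ1)
      _ ≤ ((k + m : ℝ) ^ j * R ^ k) * (k + m : ℝ) ^ m * ((p : ℝ) ^ (-β)) ^ k := by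
          gcongr
          linarith [(m.cast_nonneg : (0 : ℝ) ≤ m)]
      _ = _ := by rw [mul_pow, pow_add]; ring
  have summ : ∀ m : ℕ, Summable fun k : ℕ =>
      (k + m : ℝ) ^ (j + m) * (R * (p : ℝ) ^ (-β)) ^ k := fun m =>
    summable_add_pow_mul_geometric m (j + m) (by positivity) (mul_rpow_neg_lt_one hp hlp)
  have key := hasDerivAt_tsum_of_isPreconnected (summ (n + 1)) isOpen_Ioi
    (t := Ioi (p : ℝ)) (y₀ := s) (y := s) isPreconnected_Ioi
    (g := fun k y => powDeriv j k l * (∏ i ∈ Finset.range n, (β * k + 1 + i)) *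
      y ^ (-(β * k + 1 + n)))
    (g' := fun k y => -(powDeriv j k l * (∏ i ∈ Finset.range (n + 1), (β * k + 1 + i)) *
      y ^ (-(β * k + 1 + (n + 1 : ℕ)))))
    (fun k y hy => ?_) (fun k y hy => ?_) hs (.of_norm_bounded (summ n) fun k => bound n k s hs) hs
  · rw [tsum_neg] at key
    exact key
  · refine ((hasDerivAt_rpow_neg (β * k + 1 + n) (hp'.trans hy)).const_mul _).congr_deriv ?_
    rw [Finset.prod_range_succ]
    push_cast
    rw [← add_assoc]
    ring
  · rw [norm_neg]
    exact bound (n + 1) k y hy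

lemma resolventDeriv_nonneg {β l : ℝ} {p : ℕ} (hβ0 : 0 < β) (hβ1 : β ≤ 1) (hl : 0 < l)
    (hp : 1 ≤ p) (hlp : max 1 |l| < (p : ℝ) ^ β) (j n : ℕ) {s : ℝ} (hs : (p : ℝ) < s) :
    0 ≤ resolventDeriv β l j n s := by
  have hp' : (0 : ℝ) < p := by exact_mod_cast hp
  have h := ((completelyMonotoneUpTo_resolvent n j hβ0 hβ1 hl).mono_left hp'.le).congr
    (g := resolventDeriv β l j 0) fun x hx => resolventDeriv_zero j (hp'.trans hx) hl <|
      (le_abs_self l).trans_lt <| (le_max_right _ _).trans_lt <|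
        hlp.trans (rpow_lt_rpow hp'.le hx hβ0)
  have := h.seq_nonneg (fun n x hx => hasDerivAt_resolventDeriv hβ0 hβ1 hp hlp j n hx) hs
  rwa [zero_add] at this

/-- Up to sign, the `j`-th derivative of `x ↦ E_β(-x)`. -/
noncomputable def mittagLefflerDeriv (β : ℝ) (j : ℕ) (x : ℝ) : ℝ :=
  ∑' k : ℕ, powDeriv j k x * (Gamma (β * k + 1))⁻¹

lemma mittagLefflerDeriv_nonneg {β l : ℝ} (hβ0 : 0 < β) (hβ1 : β ≤ 1) (hl : 0 < l) (j : ℕ) :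
    0 ≤ mittagLefflerDeriv β j l := by
  obtain ⟨p, hp, hR⟩ := exists_nat_lt_rpow hβ0 (max 1 |l|)
  have hlim : Tendsto (fun n => ∑' k : ℕ, powDeriv j k l * gammaWeight n (β * k)) atTop
      (𝓝 (mittagLefflerDeriv β j l)) := by
    refine tendsto_tsum_of_dominated_convergence
      (summable_pow_mul_gammaWeight hβ0 hβ1 hp (lt_max_of_lt_left one_pos) hR j)
      (fun k => (tendsto_gammaWeight (by positivity)).const_mul _) ?_
    filter_upwards [eventually_ge_atTop p] with n hn k
    rw [norm_mul, norm_of_nonneg (gammaWeight_nonneg n (by positivity)), norm_eq_abs]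
    gcongr
    · exact gammaWeight_nonneg n (by positivity)
    · exact abs_powDeriv_le (le_max_left _ _) (le_max_right _ _)
    · exact gammaWeight_le_of_le hp hn (by positivity)
  refine ge_of_tendsto hlim ?_
  filter_upwards [eventually_gt_atTop p] with n hn
  have hn0 : (0 : ℝ) < n := by exact_mod_cast hp.trans hn.le
  have h : ∑' k : ℕ, powDeriv j k l * gammaWeight n (β * k) =
      (n : ℝ) ^ (n + 1) / n.factorial * resolventDeriv β l j n n := by
    rw [resolventDeriv, ← tsum_mul_left]
    refine tsum_congr fun k => ?_
    rw [gammaWeight, show -(β * k + 1 + n) = -(β * k) + -((n + 1 : ℕ) : ℝ) by push_cast; ring,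
      rpow_add hn0, rpow_neg hn0.le ((n + 1 : ℕ) : ℝ), rpow_natCast]
    field_simp
  rw [h]
  have := resolventDeriv_nonneg hβ0 hβ1 hl hp hR j n (s := n) (by exact_mod_cast hn)
  positivity

lemma hasDerivAt_mittagLefflerDeriv {β : ℝ} (hβ0 : 0 < β) (hβ1 : β ≤ 1) (j : ℕ) (x : ℝ) :
    HasDerivAt (mittagLefflerDeriv β j) (-(mittagLefflerDeriv β (j + 1) x)) x := by
  set R := |x| + 1
  have hR : 1 ≤ R := by simp [R]
  have bound : ∀ (m k : ℕ) (y : ℝ), y ∈ Ioo (-R) R →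
      ‖powDeriv m k y * (Gamma (β * k + 1))⁻¹‖ ≤
        (k : ℝ) ^ m * R ^ k * (Gamma (β * k + 1))⁻¹ := fun m k y hy => by
    have := Gamma_pos_of_pos (show 0 < β * k + 1 by positivity)
    rw [norm_mul, norm_of_nonneg (inv_nonneg.2 this.le), norm_eq_abs]
    gcongr
    exact abs_powDeriv_le hR (abs_lt.2 hy).le
  have summ := fun m => summable_pow_mul_inv_Gamma hβ0 hβ1 (one_pos.trans_le hR) m
  have hx : x ∈ Ioo (-R) R := abs_lt.1 (lt_add_one _)
  have key := hasDerivAt_tsum_of_isPreconnected (summ (j + 1)) isOpen_Ioo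
    (t := Ioo (-R) R) (y₀ := x) (y := x) isPreconnected_Ioo
    (g := fun k y => powDeriv j k y * (Gamma (β * k + 1))⁻¹)
    (g' := fun k y => -(powDeriv (j + 1) k y * (Gamma (β * k + 1))⁻¹))
    (fun k y _ => ((hasDerivAt_powDeriv j k y).mul_const _).congr_deriv (by ring))
    (fun k y hy => by rw [norm_neg]; exact bound (j + 1) k y hy) hx
    (.of_norm_bounded (summ j) fun k => bound j k x hx) hx
  rw [tsum_neg] at key
  exact key

/-- For `0 < α ≤ 1` and `0 < β ≤ 1`, the function `g(λ) = E_β(-λ^α)` is completely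
monotone on `(0,∞)`: it is infinitely differentiable there and
`(-1)^n g^{(n)}(λ) ≥ 0` for every `λ > 0` and every `n`. -/
theorem mittagLeffler_completelyMonotone (α β : ℝ)
    (hα0 : 0 < α) (hα1 : α ≤ 1) (hβ0 : 0 < β) (hβ1 : β ≤ 1) :
    ContDiffOn ℝ (⊤ : ℕ∞)
      (fun l : ℝ => ∑' k : ℕ, (-(l ^ α)) ^ k / Real.Gamma (β * k + 1)) (Set.Ioi 0) ∧
    ∀ n : ℕ, ∀ l : ℝ, 0 < l →
      0 ≤ (-1 : ℝ) ^ n *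
        iteratedDerivWithin n
          (fun l : ℝ => ∑' k : ℕ, (-(l ^ α)) ^ k / Real.Gamma (β * k + 1))
          (Set.Ioi 0) l := by
  have main : ∀ n, CompletelyMonotoneUpTo 0 n
      (fun l : ℝ => ∑' k : ℕ, (-(l ^ α)) ^ k / Real.Gamma (β * k + 1)) := fun n => by
    have h := CompletelyMonotoneUpTo.of_seq (c := 0) (D := mittagLefflerDeriv β)
      (fun j x hx => mittagLefflerDeriv_nonneg hβ0 hβ1 hx j)
      (fun j x _ => hasDerivAt_mittagLefflerDeriv hβ0 hβ1 j x) n 0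
    refine (h.comp (φ := fun l => l ^ α) (φ' := fun l => α * l ^ (α - 1))
      (fun x hx => by positivity) (fun x hx => hasDerivAt_rpow_const (Or.inl hx.ne'))
      (completelyMonotoneUpTo_const_mul_rpow_sub_one n hα0.le hα1)).congr fun x _ => ?_
    simp [mittagLefflerDeriv, powDeriv, div_eq_mul_inv]
  exact ⟨contDiffOn_infty.2 fun n => (main (n + 1)).contDiffOn,
    fun n l hl => (main n).iteratedDerivWithin_nonneg hl⟩
end

section
/- For every t > 0 and λ > 0, the composition of the kernel φ_{1/2} with itself produces the time-fractional kernel of order 1/4, in the sense of its Laplace transform in the second variable: ∫_0^∞ e^{-λτ} ( ∫_0^∞ φ_{1/2}(t,σ) φ_{1/2}(σ,τ) dσ ) dτ = ∑_{k=0}^∞ (-λ t^{1/4})^k / Γ(k/4 + 1). -/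
open Real MeasureTheory

/-- The subordination kernel of order `1/2`. -/
noncomputable def halfKernel (t τ : ℝ) : ℝ := exp (-τ ^ 2 / (4 * t)) / √(π * t)

lemma halfKernel_nonneg (t τ : ℝ) : 0 ≤ halfKernel t τ := by unfold halfKernel; positivity

lemma measurable_halfKernel : Measurable fun p : ℝ × ℝ => halfKernel p.1 p.2 := by
  unfold halfKernel; fun_prop

lemma rpow_mul_halfKernel (t s τ : ℝ) :
    τ ^ s * halfKernel t τ = τ ^ s * exp (-(1 / (4 * t)) * τ ^ 2) * (√(π * t))⁻¹ := by
  unfold halfKernel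
  rw [show -τ ^ 2 / (4 * t) = -(1 / (4 * t)) * τ ^ 2 by ring, div_eq_mul_inv, mul_assoc]

lemma integrableOn_rpow_mul_halfKernel {t s : ℝ} (ht : 0 < t) (hs : -1 < s) :
    IntegrableOn (fun τ => τ ^ s * halfKernel t τ) (Set.Ioi 0) := by
  simp_rw [rpow_mul_halfKernel]
  exact (integrableOn_rpow_mul_exp_neg_mul_sq (by positivity) hs).mul_const _

/-- The moments of the kernel of order `1/2`. -/
lemma integral_rpow_mul_halfKernel {t s : ℝ} (ht : 0 < t) (hs : -1 < s) :
    ∫ τ in Set.Ioi 0, τ ^ s * halfKernel t τ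
      = t ^ (s / 2) * Gamma (s + 1) / Gamma (s / 2 + 1) := by
  have h := integral_rpow_mul_exp_neg_mul_rpow (p := 2) (q := s) (b := 1 / (4 * t))
    (by norm_num) hs (by positivity)
  simp only [rpow_two] at h
  simp_rw [rpow_mul_halfKernel]
  rw [integral_mul_const, h]
  have hG : 0 < Gamma (s / 2 + 1) := Gamma_pos_of_pos (by linarith)
  have hd := Gamma_mul_Gamma_add_half ((s + 1) / 2)
  rw [show (s + 1) / 2 + 1 / 2 = s / 2 + 1 by ring, show 2 * ((s + 1) / 2) = s + 1 by ring,
    show 1 - (s + 1) = -s by ring] at hd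
  have hb : (1 / (4 * t)) ^ (-(s + 1) / 2) = 2 * 2 ^ s * (t ^ (s / 2) * √t) := by
    rw [one_div, inv_rpow (by positivity), ← rpow_neg (by positivity),
      mul_rpow (by norm_num) ht.le, show (4 : ℝ) = 2 ^ (2 : ℝ) by norm_num,
      ← rpow_mul (by norm_num), sqrt_eq_rpow, ← rpow_add ht,
      show (2 : ℝ) * -(-(s + 1) / 2) = 1 + s by ring, rpow_add (by norm_num), rpow_one]
    congr 2; ring
  have h2 : (2 : ℝ) ^ s * 2 ^ (-s) = 1 := by rw [← rpow_add (by norm_num)]; simp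
  rw [eq_div_iff hG.ne', hb, sqrt_mul pi_pos.le]
  have hπ : √π ≠ 0 := by positivity
  have hst : √t ≠ 0 := by positivity
  generalize Gamma (s / 2 + 1) = G at hd ⊢
  field_simp
  linear_combination 2 ^ s * hd + Gamma (s + 1) * √π * h2

lemma rpow_mul_exp_neg_le_Gamma_add_one {A s : ℝ} (hA : 0 < A) (hs : 0 ≤ s) :
    A ^ s * exp (-A) ≤ Gamma (s + 1) := by
  have hi := GammaIntegral_convergent (s := s + 1) (by linarith)
  rw [Gamma_eq_integral (by linarith)]
  have hsub : Set.Ioi A ⊆ Set.Ioi 0 := Set.Ioi_subset_Ioi hA.le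
  calc A ^ s * exp (-A) = ∫ x in Set.Ioi A, A ^ s * exp (-x) := by
        rw [integral_const_mul, integral_exp_neg_Ioi]
    _ ≤ ∫ x in Set.Ioi A, exp (-x) * x ^ (s + 1 - 1) := by
        refine setIntegral_mono_on ((integrableOn_exp_neg_Ioi A).const_mul _) (hi.mono_set hsub)
          measurableSet_Ioi fun x hx => ?_
        rw [add_sub_cancel_right, mul_comm]
        gcongr
        exact (Set.mem_Ioi.1 hx).le
    _ ≤ _ := by
        refine setIntegral_mono_set hi ?_ hsub.eventuallyLE
        filter_upwards [ae_restrict_mem measurableSet_Ioi] with x hx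
        have : 0 < x := hx
        simp only [Pi.zero_apply]
        positivity

lemma summable_pow_div_Gamma {a x : ℝ} (ha : 0 < a) (hx : 0 < x) :
    Summable fun k : ℕ => x ^ k / Gamma (a * k + 1) := by
  set A : ℝ := (2 * x) ^ a⁻¹ with hA
  have hA0 : 0 < A := by positivity
  refine Summable.of_nonneg_of_le (fun k => ?_) (fun k => ?_)
    ((summable_geometric_two).mul_left (exp A))
  · have : 0 < Gamma (a * k + 1) := Gamma_pos_of_pos (by positivity)
    positivity
  · have h := rpow_mul_exp_neg_le_Gamma_add_one hA0 (s := a * k) (by positivity)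
    rw [hA, ← rpow_mul (by positivity), inv_mul_cancel_left₀ ha.ne', rpow_natCast, ← hA] at h
    refine (div_le_div_of_nonneg_left (by positivity) (by positivity) h).trans_eq ?_
    rw [exp_neg, mul_pow, one_div, inv_pow]
    field_simp

lemma integral_pow_mul_halfKernel {σ : ℝ} (hσ : 0 < σ) (k : ℕ) :
    ∫ τ in Set.Ioi 0, τ ^ k * halfKernel σ τ
      = σ ^ ((k : ℝ) / 2) * k.factorial / Gamma ((k : ℝ) / 2 + 1) := by
  have h := integral_rpow_mul_halfKernel (s := k) hσ (by linarith [k.cast_nonneg (α := ℝ)])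
  simpa only [rpow_natCast, Gamma_nat_eq_factorial] using h

lemma setIntegral_pow_mul_halfKernel_mul (t : ℝ) (k : ℕ) {σ : ℝ} (hσ : 0 < σ) :
    ∫ τ in Set.Ioi 0, τ ^ k * (halfKernel t σ * halfKernel σ τ)
      = σ ^ ((k : ℝ) / 2) * halfKernel t σ * (k.factorial / Gamma ((k : ℝ) / 2 + 1)) := by
  simp_rw [mul_left_comm (_ ^ k)]
  rw [integral_const_mul, integral_pow_mul_halfKernel hσ]
  ring

lemma integrable_pow_mul_halfKernel_mul {t : ℝ} (ht : 0 < t) (k : ℕ) :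
    Integrable (fun p : ℝ × ℝ => p.2 ^ k * (halfKernel t p.1 * halfKernel p.1 p.2))
      ((volume.restrict (Set.Ioi 0)).prod (volume.restrict (Set.Ioi 0))) := by
  have hk : (-1 : ℝ) < k := by linarith [k.cast_nonneg (α := ℝ)]
  have hm : Measurable fun p : ℝ × ℝ => halfKernel t p.1 :=
    measurable_halfKernel.comp (measurable_const.prodMk measurable_fst)
  have hF : Measurable fun p : ℝ × ℝ => p.2 ^ k * (halfKernel t p.1 * halfKernel p.1 p.2) :=
    (measurable_snd.pow_const k).mul (hm.mul measurable_halfKernel)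
  refine (integrable_prod_iff hF.aestronglyMeasurable).2 ⟨?_, ?_⟩
  · filter_upwards [ae_restrict_mem measurableSet_Ioi] with σ hσ
    have h := (integrableOn_rpow_mul_halfKernel (Set.mem_Ioi.1 hσ) hk).const_mul (halfKernel t σ)
    simpa only [rpow_natCast, mul_left_comm (halfKernel t σ)] using h
  · have h := (integrableOn_rpow_mul_halfKernel (s := (k : ℝ) / 2) ht (by linarith)).mul_const
      (k.factorial / Gamma ((k : ℝ) / 2 + 1))
    refine h.congr ?_
    filter_upwards [ae_restrict_mem measurableSet_Ioi] with σ hσ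
    rw [← setIntegral_pow_mul_halfKernel_mul t k hσ]
    refine setIntegral_congr_fun measurableSet_Ioi fun τ hτ => ?_
    have hτ : 0 < τ := hτ
    exact (norm_of_nonneg (mul_nonneg (by positivity)
      (mul_nonneg (halfKernel_nonneg _ _) (halfKernel_nonneg _ _)))).symm

lemma integral_pow_mul_halfKernel_mul {t : ℝ} (ht : 0 < t) (k : ℕ) :
    ∫ p : ℝ × ℝ, p.2 ^ k * (halfKernel t p.1 * halfKernel p.1 p.2)
      ∂((volume.restrict (Set.Ioi 0)).prod (volume.restrict (Set.Ioi 0)))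
      = t ^ ((k : ℝ) / 4) * k.factorial / Gamma ((k : ℝ) / 4 + 1) := by
  have hk : (0 : ℝ) ≤ k := k.cast_nonneg
  rw [integral_prod _ (integrable_pow_mul_halfKernel_mul ht k),
    setIntegral_congr_fun measurableSet_Ioi fun σ hσ => setIntegral_pow_mul_halfKernel_mul t k hσ,
    integral_mul_const, integral_rpow_mul_halfKernel ht (by linarith)]
  have : Gamma ((k : ℝ) / 2 + 1) ≠ 0 := (Gamma_pos_of_pos (by linarith)).ne'
  rw [show (k : ℝ) / 2 / 2 = k / 4 by ring]
  field_simp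

/-- For every `t > 0` and `λ > 0`, the composition of the kernel `φ_{1/2}` with itself
produces the time-fractional kernel of order `1/4`, in the sense of its Laplace transform:
`∫_0^∞ e^{-λτ} (∫_0^∞ φ_{1/2}(t,σ) φ_{1/2}(σ,τ) dσ) dτ = E_{1/4}(-λ t^{1/4})`. -/
theorem phi_half_selfcomp_laplace (t l : ℝ) (ht : 0 < t) (hl : 0 < l) :
    ∫ τ in Set.Ioi (0 : ℝ), Real.exp (-l * τ) *
      (∫ σ in Set.Ioi (0 : ℝ),
        (Real.exp (-σ ^ 2 / (4 * t)) / Real.sqrt (Real.pi * t)) *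
          (Real.exp (-τ ^ 2 / (4 * σ)) / Real.sqrt (Real.pi * σ)))
      = ∑' k : ℕ, (-(l * t ^ (1 / 4 : ℝ))) ^ k / Real.Gamma ((k : ℝ) / 4 + 1) := by
  change ∫ τ in Set.Ioi (0 : ℝ), exp (-l * τ) *
    (∫ σ in Set.Ioi (0 : ℝ), halfKernel t σ * halfKernel σ τ) = _
  set μ : Measure ℝ := volume.restrict (Set.Ioi 0) with hμ
  have hint := integrable_pow_mul_halfKernel_mul ht
  have hpow (k : ℕ) : t ^ ((k : ℝ) / 4) = (t ^ (1 / 4 : ℝ)) ^ k := by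
    rw [← rpow_natCast, ← rpow_mul ht.le]; congr 1; ring
  have hpos : ∀ᵐ p ∂(μ.prod μ), 0 < p.2 :=
    Measure.quasiMeasurePreserving_snd.ae (ae_restrict_mem measurableSet_Ioi)
  have hnonneg (p : ℝ × ℝ) : 0 ≤ halfKernel t p.1 * halfKernel p.1 p.2 :=
    mul_nonneg (halfKernel_nonneg _ _) (halfKernel_nonneg _ _)
  let F (k : ℕ) (p : ℝ × ℝ) : ℝ :=
    (-l) ^ k / k.factorial * (p.2 ^ k * (halfKernel t p.1 * halfKernel p.1 p.2))
  have hF (k : ℕ) : ∫ p, F k p ∂(μ.prod μ)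
      = (-(l * t ^ (1 / 4 : ℝ))) ^ k / Gamma ((k : ℝ) / 4 + 1) := by
    rw [integral_const_mul, integral_pow_mul_halfKernel_mul ht, hpow, ← neg_mul, mul_pow]
    field_simp
  have hnorm (k : ℕ) : ∫ p, ‖F k p‖ ∂(μ.prod μ)
      = (l * t ^ (1 / 4 : ℝ)) ^ k / Gamma (1 / 4 * k + 1) := by
    have : ∀ᵐ p ∂(μ.prod μ), ‖F k p‖
        = l ^ k / k.factorial * (p.2 ^ k * (halfKernel t p.1 * halfKernel p.1 p.2)) := by
      filter_upwards [hpos] with p hp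
      rw [norm_mul, norm_of_nonneg (mul_nonneg (pow_nonneg hp.le k) (hnonneg p)), norm_div,
        norm_pow, norm_neg, norm_of_nonneg hl.le, norm_natCast]
    rw [integral_congr_ae this, integral_const_mul, integral_pow_mul_halfKernel_mul ht, hpow,
      mul_pow, one_div_mul_eq_div]
    field_simp
  have hexp (p : ℝ × ℝ) :
      ∑' k, F k p = exp (-l * p.2) * (halfKernel t p.1 * halfKernel p.1 p.2) := by
    rw [exp_eq_exp_ℝ, NormedSpace.exp_eq_tsum_div, ← tsum_mul_right]
    refine tsum_congr fun k => ?_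
    simp only [F, mul_pow]
    ring
  have hsum := integral_tsum_of_summable_integral_norm (μ := μ.prod μ) (F := F)
    (fun k => (hint k).const_mul _)
    ((summable_pow_div_Gamma (a := 1 / 4) (by norm_num) (by positivity)).congr
      fun k => (hnorm k).symm)
  simp_rw [hF, hexp] at hsum
  rw [hsum]
  have hL : Integrable (fun p : ℝ × ℝ => exp (-l * p.2) *
      (halfKernel t p.1 * halfKernel p.1 p.2)) (μ.prod μ) := by
    have h0 : Integrable (fun p : ℝ × ℝ => halfKernel t p.1 * halfKernel p.1 p.2) (μ.prod μ) := by
      simpa using hint 0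
    refine h0.bdd_mul (c := 1) (by fun_prop) ?_
    filter_upwards [hpos] with p hp
    rw [norm_of_nonneg (exp_pos _).le, exp_le_one_iff]
    nlinarith
  rw [integral_prod_symm _ hL]
  simp_rw [integral_const_mul]
end

section
/- Let 0 < α < 1. For every λ > 0, the Laplace transform of the kernel K_{α,α} is the Mittag-Leffler function E_α(-λ^α): ∫_0^∞ e^{-λr} · (1/π) · (r^{α-1} sin(απ)) / (r^{2α} + 2 r^α cos(απ) + 1) dr = ∑_{k=0}^∞ (-λ^α)^k / Γ(αk + 1). -/
open Real MeasureTheory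

open Filter Topology Complex in
/-- Cauchy's theorem on the half strip `re u ≤ b`, `|im u| ≤ π`. -/
lemma integral_halfStrip_boundary (g : ℂ → ℂ) (b C c : ℝ) (hc : 0 < c)
    (hd : ∀ u : ℂ, |u.im| ≤ π → DifferentiableAt ℂ g u)
    (hg : ∀ u : ℂ, u.re ≤ b → |u.im| ≤ π → ‖g u‖ ≤ C * Real.exp (c * u.re)) :
    I * ∫ θ in (-π)..π, g (b + θ * I) =
      ∫ x in Set.Iic b, (g (x + π * I) - g (x - π * I)) := by
  have hpi := Real.pi_pos
  have hcont : ∀ y : ℝ, |y| ≤ π → Continuous fun x : ℝ => g (x + y * I) := by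
    intro y hy
    refine continuous_iff_continuousAt.2 fun x => ?_
    have h1 : ContinuousAt g ((x : ℂ) + y * I) := (hd _ (by simpa using hy)).continuousAt
    exact ContinuousAt.comp (f := fun x : ℝ => (x : ℂ) + y * I) h1 (by fun_prop)
  have hint : ∀ y : ℝ, |y| ≤ π → IntegrableOn (fun x : ℝ => g (x + y * I)) (Set.Iic b) := by
    intro y hy
    refine Integrable.mono' ((integrableOn_exp_mul_Iic hc b).const_mul C)
      (hcont y hy).aestronglyMeasurable ?_
    filter_upwards [ae_restrict_mem measurableSet_Iic] with x hx
    simpa using hg (x + y * I) (by simpa using hx) (by simpa using hy)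
  have e1 : ∀ x : ℝ, (x : ℂ) - π * I = x + (-π : ℝ) * I := by intro x; push_cast; ring
  have hp : |π| ≤ π := by rw [abs_of_pos hpi]
  have hm : |-π| ≤ π := by rw [abs_neg, abs_of_pos hpi]
  simp_rw [e1]
  rw [integral_sub (hint π hp) (hint (-π) hm)]
  have rect : ∀ a : ℝ, (∫ x in a..b, g (x + π * I)) - (∫ x in a..b, g (x + (-π : ℝ) * I)) =
      I * (∫ θ in (-π)..π, g (b + θ * I)) - I * ∫ θ in (-π)..π, g (a + θ * I) := by
    intro a
    have := Complex.integral_boundary_rect_eq_zero_of_differentiableOn g ⟨a, -π⟩ ⟨b, π⟩ ?_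
    · simp only [smul_eq_mul] at this
      linear_combination -this
    · intro u hu
      have h2 := hu.2
      simp only [Set.mem_preimage] at h2
      rw [Set.uIcc_of_le (by linarith)] at h2
      exact (hd u (abs_le.2 h2)).differentiableWithinAt
  have lim1 := (intervalIntegral_tendsto_integral_Iic b (hint π hp) tendsto_id).sub
    (intervalIntegral_tendsto_integral_Iic b (hint (-π) hm) tendsto_id)
  simp only [id, rect] at lim1
  have lim0 : Tendsto (fun a : ℝ => ∫ θ in (-π)..π, g (a + θ * I)) atBot (𝓝 0) := by
    have hb : ∀ᶠ a : ℝ in atBot, ‖∫ θ in (-π)..π, g (a + θ * I)‖ ≤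
        C * Real.exp (c * a) * |π - -π| := by
      filter_upwards [eventually_le_atBot b] with a ha
      refine intervalIntegral.norm_integral_le_of_norm_le_const fun θ hθ => ?_
      rw [Set.uIoc_of_le (by linarith)] at hθ
      simpa using hg (a + θ * I) (by simpa using ha)
        (by simpa using abs_le.2 ⟨hθ.1.le, hθ.2⟩)
    refine squeeze_zero_norm' hb ?_
    have : Tendsto (fun a : ℝ => Real.exp (c * a)) atBot (𝓝 0) :=
      Real.tendsto_exp_atBot.comp (tendsto_id.const_mul_atBot hc)
    simpa using (this.const_mul C).mul_const |π - -π|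
  have lim2 := (tendsto_const_nhds (x := I * ∫ θ in (-π)..π, g (b + θ * I))).sub (lim0.const_mul I)
  simp only [mul_zero, sub_zero] at lim2
  exact tendsto_nhds_unique lim2 lim1

/-- `exp (-l r) r ^ (-s)` in the variable `x = log r`. -/
noncomputable def expKernel (l s x : ℝ) : ℝ := Real.exp (-l * Real.exp x) * Real.exp (-s * x)

lemma expKernel_pos (l s x : ℝ) : 0 < expKernel l s x := by unfold expKernel; positivity

lemma continuous_expKernel (l s : ℝ) : Continuous (expKernel l s) := by
  unfold expKernel; fun_prop

lemma integral_comp_exp_mul (f : ℝ → ℝ) :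
    ∫ r in Set.Ioi (0 : ℝ), f r = ∫ x : ℝ, Real.exp x * f (Real.exp x) := by
  have := integral_image_eq_integral_abs_deriv_smul (s := Set.univ) (f := Real.exp)
    (f' := Real.exp) MeasurableSet.univ
    (fun x _ => (Real.hasDerivAt_exp x).hasDerivWithinAt) Real.exp_injective.injOn f
  simpa [Set.image_univ, Real.range_exp] using this

lemma integrable_exp_mul_comp_iff (f : ℝ → ℝ) :
    IntegrableOn f (Set.Ioi 0) ↔ Integrable fun x : ℝ => Real.exp x * f (Real.exp x) := by
  have := integrableOn_image_iff_integrableOn_abs_deriv_smul (s := Set.univ) (f := Real.exp)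
    (f' := Real.exp) MeasurableSet.univ
    (fun x _ => (Real.hasDerivAt_exp x).hasDerivWithinAt) Real.exp_injective.injOn f
  simpa [Set.image_univ, Real.range_exp] using this

lemma expKernel_eq_rpow (l s x : ℝ) :
    expKernel l s x =
      Real.exp x * (Real.exp x ^ (-s - 1) * Real.exp (-(l * Real.exp x))) := by
  rw [expKernel, ← Real.exp_mul, ← Real.exp_add, ← Real.exp_add, ← Real.exp_add]
  congr 1; ring

lemma integrable_expKernel {l s : ℝ} (hl : 0 < l) (hs : s < 0) : Integrable (expKernel l s) := by
  have h := integrableOn_rpow_mul_exp_neg_mul_rpow (p := 1) (s := -s - 1) (b := l)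
    (by linarith) one_pos hl
  simp only [Real.rpow_one] at h
  rw [integrable_exp_mul_comp_iff] at h
  refine h.congr (ae_of_all _ fun x => ?_)
  simp only [expKernel_eq_rpow, neg_mul]

lemma integral_expKernel {l s : ℝ} (hl : 0 < l) (hs : s < 0) :
    ∫ x, expKernel l s x = l ^ s * Real.Gamma (-s) := by
  have h := Real.integral_rpow_mul_exp_neg_mul_Ioi (a := -s) (r := l) (by linarith) hl
  rw [integral_comp_exp_mul] at h
  simp only [expKernel_eq_rpow, h, one_div]
  rw [Real.rpow_neg (by positivity), Real.inv_rpow hl.le, inv_inv]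

lemma expKernel_le_tail {l s b x : ℝ} (hs : -1 ≤ s) (hx : b ≤ x) :
    expKernel l s x ≤ Real.exp (-(s + 1) * b) * expKernel l (-1) x := by
  have : expKernel l s x = Real.exp (-(s + 1) * x) * expKernel l (-1) x := by
    simp only [expKernel, ← Real.exp_add]; congr 1; ring
  rw [this]
  refine mul_le_mul_of_nonneg_right (Real.exp_le_exp.2 ?_) (expKernel_pos _ _ _).le
  nlinarith

lemma integrableOn_expKernel_Ioi {l s : ℝ} (hl : 0 < l) (hs : -1 ≤ s) (b : ℝ) :
    IntegrableOn (expKernel l s) (Set.Ioi b) := by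
  refine Integrable.mono' (((integrable_expKernel hl (s := -1) (by norm_num)).const_mul
    (Real.exp (-(s + 1) * b))).integrableOn) (continuous_expKernel l s).aestronglyMeasurable ?_
  filter_upwards [ae_restrict_mem measurableSet_Ioi] with x hx
  rw [Real.norm_of_nonneg (expKernel_pos _ _ _).le]
  exact expKernel_le_tail hs (le_of_lt hx)

lemma integral_expKernel_Ioi_le {l s : ℝ} (hl : 0 < l) (hs : -1 ≤ s) (b : ℝ) :
    ∫ x in Set.Ioi b, expKernel l s x ≤ Real.exp (-(s + 1) * b) / l := by
  have hi := integrable_expKernel hl (s := -1) (by norm_num)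
  calc ∫ x in Set.Ioi b, expKernel l s x
      ≤ ∫ x in Set.Ioi b, Real.exp (-(s + 1) * b) * expKernel l (-1) x :=
        setIntegral_mono_on (integrableOn_expKernel_Ioi hl hs b) (hi.const_mul _).integrableOn
          measurableSet_Ioi fun x hx => expKernel_le_tail hs (le_of_lt hx)
    _ ≤ ∫ x, Real.exp (-(s + 1) * b) * expKernel l (-1) x :=
        setIntegral_le_integral (hi.const_mul _)
          (ae_of_all _ fun x => (mul_pos (Real.exp_pos _) (expKernel_pos l (-1) x)).le)
    _ = Real.exp (-(s + 1) * b) / l := by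
        rw [integral_const_mul, integral_expKernel hl (by norm_num), neg_neg, Real.Gamma_one,
          Real.rpow_neg_one]
        ring

open Filter Topology in
lemma expKernel_tail_recurrence {l s : ℝ} (hl : 0 < l) (hs : 0 ≤ s) (b : ℝ) :
    l * (∫ x in Set.Ioi b, expKernel l (s - 1) x) + s * ∫ x in Set.Ioi b, expKernel l s x =
      expKernel l s b := by
  have i1 := (integrableOn_expKernel_Ioi hl (s := s - 1) (by linarith) b).const_mul l
  have i2 := (integrableOn_expKernel_Ioi hl (s := s) (by linarith) b).const_mul s
  have hder : ∀ x : ℝ, HasDerivAt (fun x => - expKernel l s x)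
      (l * expKernel l (s - 1) x + s * expKernel l s x) x := by
    intro x
    have h1 : HasDerivAt (fun x => Real.exp (-l * Real.exp x))
        (Real.exp (-l * Real.exp x) * (-l * Real.exp x)) x :=
      ((Real.hasDerivAt_exp x).const_mul (-l)).exp
    have h2 : HasDerivAt (fun x => Real.exp (-s * x)) (Real.exp (-s * x) * (-s * 1)) x :=
      ((hasDerivAt_id x).const_mul (-s)).exp
    refine (show HasDerivAt (fun x => - expKernel l s x) _ x from (h1.mul h2).neg).congr_deriv ?_
    have : Real.exp (-(s - 1) * x) = Real.exp x * Real.exp (-s * x) := by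
      rw [← Real.exp_add]; congr 1; ring
    simp only [expKernel, this]; ring
  have hlim : Tendsto (fun x => - expKernel l s x) atTop (𝓝 0) := by
    rw [← neg_zero]
    refine Tendsto.neg ?_
    have h0 : Tendsto (fun x => Real.exp (-l * Real.exp x)) atTop (𝓝 0) :=
      Real.tendsto_exp_atBot.comp (Real.tendsto_exp_atTop.const_mul_atTop_of_neg (by linarith))
    refine squeeze_zero' (Eventually.of_forall fun x => (expKernel_pos _ _ _).le) ?_ h0
    filter_upwards [eventually_ge_atTop 0] with x hx
    refine mul_le_of_le_one_right (Real.exp_pos _).le (Real.exp_le_one_iff.2 ?_)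
    nlinarith
  have := integral_Ioi_of_hasDerivAt_of_tendsto (a := b) (hder b).continuousAt.continuousWithinAt
    (fun x _ => hder x) (i1.add i2) hlim
  rw [integral_add i1 i2, integral_const_mul, integral_const_mul] at this
  linarith

/-- `exp (l z) z ^ (-s)` in the variable `u = log z`. -/
noncomputable def cexpKernel (l s : ℝ) (u : ℂ) : ℂ :=
  Complex.exp (l * Complex.exp u) * Complex.exp (-s * u)

lemma differentiable_cexpKernel (l s : ℝ) : Differentiable ℂ (cexpKernel l s) := by
  unfold cexpKernel; fun_prop

lemma exp_add_pi_mul_I (x : ℝ) : Complex.exp (x + π * Complex.I) = -(Real.exp x : ℝ) := by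
  rw [Complex.exp_add, Complex.exp_pi_mul_I]; push_cast; ring

lemma exp_sub_pi_mul_I (x : ℝ) : Complex.exp (x - π * Complex.I) = -(Real.exp x : ℝ) := by
  rw [Complex.exp_sub, Complex.exp_pi_mul_I]; push_cast; ring

lemma cexpKernel_jump (l s x : ℝ) :
    cexpKernel l s (x + π * Complex.I) - cexpKernel l s (x - π * Complex.I) =
      Complex.I * (-2 * Real.sin (π * s) * expKernel l s x : ℝ) := by
  have h1 : Complex.exp (-s * (x + π * Complex.I)) =
      Complex.exp (-s * x) * Complex.exp (-(π * s) * Complex.I) := by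
    rw [← Complex.exp_add]; congr 1; ring
  have h2 : Complex.exp (-s * (x - π * Complex.I)) =
      Complex.exp (-s * x) * Complex.exp ((π * s) * Complex.I) := by
    rw [← Complex.exp_add]; congr 1; ring
  rw [cexpKernel, cexpKernel, exp_add_pi_mul_I, exp_sub_pi_mul_I, h1, h2, expKernel,
    Complex.exp_mul_I, Complex.exp_mul_I, Complex.cos_neg, Complex.sin_neg]
  push_cast
  have : ((l : ℂ) * -Complex.exp x) = -l * Complex.exp x := by ring
  rw [this]
  ring

lemma norm_exp_mul_exp_le {l b : ℝ} (hl : 0 < l) {u : ℂ} (hu : u.re ≤ b) :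
    ‖Complex.exp (l * Complex.exp u)‖ ≤ Real.exp (l * Real.exp b) := by
  refine (Complex.norm_exp_le_exp_norm _).trans (Real.exp_le_exp.2 ?_)
  rw [norm_mul, Complex.norm_exp, Complex.norm_real, Real.norm_of_nonneg hl.le]
  exact mul_le_mul_of_nonneg_left (Real.exp_le_exp.2 hu) hl.le

/-- The integral of `exp (l z) z ^ (-s)` over the circle of radius `exp b`. -/
noncomputable def circleKernel (l s b : ℝ) : ℂ :=
  ∫ θ in (-π)..π, cexpKernel l s (b + θ * Complex.I)

lemma circleKernel_of_neg {l s : ℝ} (hl : 0 < l) (hs : s < 0) (b : ℝ) :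
    circleKernel l s b = (-2 * Real.sin (π * s) * ∫ x in Set.Iic b, expKernel l s x : ℝ) := by
  have h := integral_halfStrip_boundary (cexpKernel l s) b (Real.exp (l * Real.exp b)) (-s)
    (by linarith) (fun u _ => (differentiable_cexpKernel l s) u) ?_
  · simp_rw [cexpKernel_jump] at h
    rw [integral_const_mul, integral_complex_ofReal, integral_const_mul] at h
    exact mul_left_cancel₀ Complex.I_ne_zero h
  · intro u hu _
    rw [cexpKernel, norm_mul]
    refine mul_le_mul (norm_exp_mul_exp_le hl hu) ?_ (norm_nonneg _) (Real.exp_pos _).le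
    rw [Complex.norm_exp]
    simp

lemma circleKernel_zero {l : ℝ} (hl : 0 < l) (b : ℝ) :
    circleKernel l 0 b = (2 * π : ℝ) := by
  have h := integral_halfStrip_boundary (fun u => Complex.exp (l * Complex.exp u) - 1) b
    (l * Real.exp (l * Real.exp b)) 1 one_pos (fun u _ => by fun_prop) ?_
  · simp only [exp_add_pi_mul_I, exp_sub_pi_mul_I, sub_self, integral_zero] at h
    have h' := (mul_eq_zero.1 h).resolve_left Complex.I_ne_zero
    rw [intervalIntegral.integral_sub
      (Continuous.intervalIntegrable (by fun_prop) _ _) (by simp)] at h'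
    rw [intervalIntegral.integral_const, sub_eq_zero] at h'
    simp only [circleKernel, cexpKernel, Complex.ofReal_zero, neg_zero, zero_mul, Complex.exp_zero,
      mul_one, h']
    simp; ring
  · intro u hu _
    have h1 := Complex.norm_exp_sub_sum_le_norm_mul_exp (l * Complex.exp u) 1
    simp only [Finset.range_one, Finset.sum_singleton, pow_zero, Nat.factorial_zero, Nat.cast_one,
      div_one, pow_one, norm_mul, Complex.norm_exp, Complex.norm_real,
      Real.norm_of_nonneg hl.le] at h1
    refine h1.trans ?_
    have h2 : Real.exp (l * Real.exp u.re) ≤ Real.exp (l * Real.exp b) :=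
      Real.exp_le_exp.2 (mul_le_mul_of_nonneg_left (Real.exp_le_exp.2 hu) hl.le)
    rw [one_mul, mul_right_comm]
    gcongr

lemma circleKernel_recurrence (l s b : ℝ) :
    l * circleKernel l (s - 1) b - s * circleKernel l s b =
      (-2 * Real.sin (π * s) * expKernel l s b : ℝ) := by
  have hc : ∀ t, Continuous fun θ : ℝ => cexpKernel l t (b + θ * Complex.I) := fun t =>
    (differentiable_cexpKernel l t).continuous.comp (by fun_prop)
  have hder : ∀ θ : ℝ, HasDerivAt (fun θ : ℝ => cexpKernel l s (b + θ * Complex.I))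
      (Complex.I * (l * cexpKernel l (s - 1) (b + θ * Complex.I) -
        s * cexpKernel l s (b + θ * Complex.I))) θ := by
    intro θ
    have h0 : HasDerivAt (fun θ : ℝ => (b : ℂ) + θ * Complex.I) (1 * Complex.I) θ :=
      (Complex.ofRealCLM.hasDerivAt.mul_const Complex.I).const_add _
    have h1 := ((h0.cexp).const_mul (l : ℂ)).cexp
    have h2 := (h0.const_mul (-s : ℂ)).cexp
    refine (show HasDerivAt (fun θ : ℝ => cexpKernel l s (b + θ * Complex.I)) _ θ from
      h1.mul h2).congr_deriv ?_
    have : Complex.exp (-((s - 1 : ℝ) : ℂ) * (b + θ * Complex.I)) =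
        Complex.exp (b + θ * Complex.I) * Complex.exp (-s * (b + θ * Complex.I)) := by
      rw [← Complex.exp_add]; congr 1; push_cast; ring
    simp only [cexpKernel, this]; ring
  have h := intervalIntegral.integral_eq_sub_of_hasDerivAt (a := -π) (b := π)
    (fun θ _ => hder θ) (Continuous.intervalIntegrable
      (continuous_const.mul (((hc _).const_mul _).sub ((hc _).const_mul _))) _ _)
  rw [intervalIntegral.integral_const_mul, intervalIntegral.integral_sub
    (((hc _).const_mul _).intervalIntegrable _ _) (((hc _).const_mul _).intervalIntegrable _ _),
    intervalIntegral.integral_const_mul, intervalIntegral.integral_const_mul] at h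
  refine mul_left_cancel₀ Complex.I_ne_zero ?_
  rw [circleKernel, circleKernel, h, ← cexpKernel_jump]
  congr 2; push_cast; ring

/-- Hankel's formula for the reciprocal Gamma function, with the contour consisting of a circle of
radius `exp b` and the two sides of the cut `(-∞, -exp b]`. -/
lemma circleKernel_eq {l : ℝ} (hl : 0 < l) (b : ℝ) {s : ℝ} (hs : -1 < s) :
    circleKernel l s b = (2 * π * (l ^ s / Real.Gamma (s + 1)) +
      2 * Real.sin (π * s) * ∫ x in Set.Ioi b, expKernel l s x : ℝ) := by
  obtain ⟨n, hn⟩ := exists_nat_ge s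
  induction n generalizing s with
  | zero =>
    rcases (show s ≤ 0 by simpa using hn).lt_or_eq with h | rfl
    · rw [circleKernel_of_neg hl h]
      congr 1
      have hsplit := intervalIntegral.integral_Iic_add_Ioi (b := b)
        (integrable_expKernel hl h).integrableOn (integrable_expKernel hl h).integrableOn
      rw [integral_expKernel hl h] at hsplit
      have hrefl := Real.Gamma_mul_Gamma_one_sub (-s)
      have hG : Real.Gamma (s + 1) ≠ 0 := (Real.Gamma_pos_of_pos (by linarith)).ne'
      have hsin : Real.sin (π * s) ≠ 0 := by
        have : 0 < Real.sin (π * -s) := Real.sin_pos_of_pos_of_lt_pi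
          (by nlinarith [Real.pi_pos]) (by nlinarith [Real.pi_pos])
        rw [mul_neg, Real.sin_neg] at this
        linarith
      rw [show (1 : ℝ) - -s = s + 1 by ring, mul_neg, Real.sin_neg] at hrefl
      have key : π * (l ^ s / Real.Gamma (s + 1)) =
          -(Real.sin (π * s) * (l ^ s * Real.Gamma (-s))) := by
        have hrefl' : Real.Gamma (-s) * Real.Gamma (s + 1) * Real.sin (π * s) = -π := by
          rw [hrefl]; field_simp
        rw [mul_div_assoc', div_eq_iff hG]
        linear_combination l ^ s * hrefl'
      rw [← hsplit] at key
      linear_combination -2 * key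
    · rw [circleKernel_zero hl]
      simp
  | succ n ih =>
    rcases le_or_gt s n with h | h
    · exact ih hs h
    have hs0 : 0 < s := lt_of_le_of_lt (Nat.cast_nonneg n) h
    have hprev := ih (s := s - 1) (by linarith) (by push_cast at hn; linarith)
    have hrec := circleKernel_recurrence l s b
    have htail := expKernel_tail_recurrence hl hs0.le b
    have hs' : (s : ℂ) ≠ 0 := by exact_mod_cast hs0.ne'
    rw [hprev] at hrec
    refine mul_left_cancel₀ hs' ?_
    have hG : Real.Gamma (s + 1) = s * Real.Gamma s := Real.Gamma_add_one hs0.ne'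
    have hGs : Real.Gamma s ≠ 0 := (Real.Gamma_pos_of_pos hs0).ne'
    have hpow : l ^ s = l * l ^ (s - 1) := by
      rw [Real.rpow_sub_one hl.ne']; field_simp
    have hsin : Real.sin (π * (s - 1)) = - Real.sin (π * s) := by
      rw [mul_sub, mul_one, Real.sin_sub_pi]
    have h3 : (s : ℂ) * circleKernel l s b =
        (l * (2 * π * (l ^ (s - 1) / Real.Gamma (s - 1 + 1)) + 2 * Real.sin (π * (s - 1)) *
          ∫ x in Set.Ioi b, expKernel l (s - 1) x) + 2 * Real.sin (π * s) * expKernel l s b : ℝ) := by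
      push_cast at hrec ⊢
      linear_combination -hrec
    rw [h3, ← Complex.ofReal_mul]
    congr 1
    rw [sub_add_cancel, hG, hpow, hsin, ← htail]
    field_simp
    ring

lemma sin_mul_pi_pos {α : ℝ} (hα0 : 0 < α) (hα1 : α < 1) : 0 < Real.sin (α * π) :=
  Real.sin_pos_of_pos_of_lt_pi (by positivity) (by nlinarith [Real.pi_pos])

lemma sin_mul_exp_le_norm_one_add_exp {α : ℝ} (hα0 : 0 < α) (hα1 : α < 1) {u : ℂ}
    (hu : |u.im| ≤ π) :
    Real.sin (α * π) * Real.exp (-α * u.re) ≤ ‖1 + Complex.exp (-α * u)‖ := by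
  have hcos : Real.cos (α * π) ≤ Real.cos (α * u.im) := by
    rw [← Real.cos_abs (α * u.im), abs_mul, abs_of_pos hα0]
    exact Real.cos_le_cos_of_nonneg_of_le_pi (by positivity) (by nlinarith [Real.pi_pos])
      (by gcongr)
  refine (sq_le_sq₀ (mul_pos (sin_mul_pi_pos hα0 hα1) (Real.exp_pos _)).le (norm_nonneg _)).1 ?_
  rw [Complex.sq_norm, Complex.normSq_apply]
  have hre : (1 + Complex.exp (-α * u)).re =
      1 + Real.exp (-α * u.re) * Real.cos (α * u.im) := by
    simp [Complex.exp_re]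
  have him : (1 + Complex.exp (-α * u)).im = -(Real.exp (-α * u.re) * Real.sin (α * u.im)) := by
    simp [Complex.exp_im]
  rw [hre, him]
  set ρ := Real.exp (-α * u.re)
  have hρ : 0 < ρ := Real.exp_pos _
  have h1 := Real.sin_sq_add_cos_sq (α * u.im)
  have h2 := Real.sin_sq_add_cos_sq (α * π)
  have h3 := mul_le_mul_of_nonneg_left hcos hρ.le
  have h4 : (1 + ρ * Real.cos (α * u.im)) * (1 + ρ * Real.cos (α * u.im)) +
      -(ρ * Real.sin (α * u.im)) * -(ρ * Real.sin (α * u.im)) =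
      1 + 2 * (ρ * Real.cos (α * u.im)) + ρ ^ 2 := by
    linear_combination ρ ^ 2 * h1
  have h5 : (Real.sin (α * π) * ρ) ^ 2 = ρ ^ 2 - (ρ * Real.cos (α * π)) ^ 2 := by
    linear_combination ρ ^ 2 * h2
  rw [h4, h5]
  nlinarith [sq_nonneg (1 + ρ * Real.cos (α * π))]

lemma one_add_exp_ne_zero {α : ℝ} (hα0 : 0 < α) (hα1 : α < 1) {u : ℂ} (hu : |u.im| ≤ π) :
    1 + Complex.exp (-α * u) ≠ 0 := by
  rw [← norm_pos_iff]
  exact (mul_pos (sin_mul_pi_pos hα0 hα1) (Real.exp_pos _)).trans_le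
    (sin_mul_exp_le_norm_one_add_exp hα0 hα1 hu)

/-- The integrand `exp (-l r) K_{α,α}(r)` times `r`, in the variable `x = log r`. -/
noncomputable def logKernel (α l x : ℝ) : ℝ :=
  Real.exp x * (Real.exp (-l * Real.exp x) * ((1 / π) *
    (Real.exp x ^ (α - 1) * Real.sin (α * π)) /
      (Real.exp x ^ (2 * α) + 2 * Real.exp x ^ α * Real.cos (α * π) + 1)))

lemma logKernel_eq (α l x : ℝ) : logKernel α l x =
    Real.exp (-l * Real.exp x) * (Real.sin (α * π) * Real.exp (-α * x) /
      (π * (1 + 2 * Real.exp (-α * x) * Real.cos (α * π) + Real.exp (-α * x) ^ 2))) := by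
  have h1 : Real.exp x ^ (α - 1) = Real.exp (α * x) / Real.exp x := by
    rw [← Real.exp_mul, ← Real.exp_sub]; congr 1; ring
  have h2 : Real.exp x ^ (2 * α) = Real.exp (α * x) ^ 2 := by
    rw [← Real.exp_mul, sq, ← Real.exp_add]; congr 1; ring
  have h3 : Real.exp x ^ α = Real.exp (α * x) := by
    rw [← Real.exp_mul]; congr 1; ring
  have h4 : Real.exp (-α * x) = (Real.exp (α * x))⁻¹ := by
    rw [← Real.exp_neg]; congr 1; ring
  rw [logKernel, h1, h2, h3, h4]
  have hw := Real.exp_pos (α * x)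
  set w := Real.exp (α * x)
  have h5 : 1 + 2 * w⁻¹ * Real.cos (α * π) + w⁻¹ ^ 2 =
      (w ^ 2 + 2 * w * Real.cos (α * π) + 1) / w ^ 2 := by
    field_simp
  rw [h5]
  field_simp

lemma sin_sq_mul_sq_le (φ ρ : ℝ) :
    (Real.sin φ * ρ) ^ 2 ≤ 1 + 2 * ρ * Real.cos φ + ρ ^ 2 := by
  nlinarith [sq_nonneg (1 + ρ * Real.cos φ), Real.sin_sq_add_cos_sq φ]

lemma logKernel_denom_pos {α : ℝ} (hα0 : 0 < α) (hα1 : α < 1) (x : ℝ) :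
    0 < 1 + 2 * Real.exp (-α * x) * Real.cos (α * π) + Real.exp (-α * x) ^ 2 :=
  (pow_pos (mul_pos (sin_mul_pi_pos hα0 hα1) (Real.exp_pos _)) 2).trans_le
    (sin_sq_mul_sq_le _ _)

lemma integrable_logKernel {α l : ℝ} (hα0 : 0 < α) (hα1 : α < 1) (hl : 0 < l) :
    Integrable (logKernel α l) := by
  have hs := sin_mul_pi_pos hα0 hα1
  have hcont : Continuous (logKernel α l) := by
    simp_rw [funext (logKernel_eq α l)]
    have := fun x => (mul_pos Real.pi_pos (logKernel_denom_pos hα0 hα1 x)).ne'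
    fun_prop (disch := assumption)
  refine Integrable.mono' ((integrable_expKernel hl (s := -α) (by linarith)).const_mul
    (1 / (π * Real.sin (α * π)))) hcont.aestronglyMeasurable (ae_of_all _ fun x => ?_)
  have hd := logKernel_denom_pos hα0 hα1 x
  have hle := sin_sq_mul_sq_le (α * π) (Real.exp (-α * x))
  rw [logKernel_eq, Real.norm_of_nonneg (by positivity), expKernel, neg_neg]
  rw [mul_left_comm]
  refine mul_le_mul_of_nonneg_left ?_ (Real.exp_pos _).le
  have h4 : Real.exp (α * x) = (Real.exp (-α * x))⁻¹ := by
    rw [← Real.exp_neg]; congr 1; ring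
  rw [h4]
  have hρ := Real.exp_pos (-α * x)
  set ρ := Real.exp (-α * x)
  rw [← one_div, div_mul_div_comm, div_le_div_iff₀ (by positivity) (by positivity)]
  have := mul_le_mul_of_nonneg_left hle Real.pi_pos.le
  linarith

lemma logKernel_jump {α : ℝ} (hα0 : 0 < α) (hα1 : α < 1) (l x : ℝ) :
    Complex.exp (l * Complex.exp (x + π * Complex.I)) /
        (1 + Complex.exp (-α * (x + π * Complex.I))) -
      Complex.exp (l * Complex.exp (x - π * Complex.I)) /
        (1 + Complex.exp (-α * (x - π * Complex.I))) =
      Complex.I * (2 * π * logKernel α l x : ℝ) := by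
  have n1 := one_add_exp_ne_zero hα0 hα1 (u := x + π * Complex.I)
    (by simp [abs_of_pos Real.pi_pos])
  have n2 := one_add_exp_ne_zero hα0 hα1 (u := x - π * Complex.I)
    (by simp [abs_of_pos Real.pi_pos])
  have h1 : Complex.exp (-α * (x + π * Complex.I)) = (Real.exp (-α * x) : ℝ) *
      ((Real.cos (α * π) : ℝ) - (Real.sin (α * π) : ℝ) * Complex.I) := by
    rw [show (-α : ℂ) * (x + π * Complex.I) = -α * x + (-(α * π)) * Complex.I by ring,
      Complex.exp_add, Complex.exp_mul_I, Complex.cos_neg, Complex.sin_neg]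
    push_cast; ring
  have h2 : Complex.exp (-α * (x - π * Complex.I)) = (Real.exp (-α * x) : ℝ) *
      ((Real.cos (α * π) : ℝ) + (Real.sin (α * π) : ℝ) * Complex.I) := by
    rw [show (-α : ℂ) * (x - π * Complex.I) = -α * x + (α * π) * Complex.I by ring,
      Complex.exp_add, Complex.exp_mul_I]
    push_cast; ring
  have h3 : (l : ℂ) * -(Real.exp x : ℝ) = (-l * Real.exp x : ℝ) := by push_cast; ring
  rw [exp_add_pi_mul_I, exp_sub_pi_mul_I, h3, ← Complex.ofReal_exp, logKernel_eq]
  rw [h1] at n1 ⊢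
  rw [h2] at n2 ⊢
  have hd := (logKernel_denom_pos hα0 hα1 x).ne'
  set ρ := Real.exp (-α * x)
  set c := Real.cos (α * π) with hc
  set s := Real.sin (α * π) with hs
  have hsc : (s : ℂ) ^ 2 + (c : ℂ) ^ 2 = 1 := by
    exact_mod_cast Real.sin_sq_add_cos_sq (α * π)
  have hprod : ((1 : ℂ) + ρ * (c - s * Complex.I)) * (1 + ρ * (c + s * Complex.I)) =
      ((1 + 2 * ρ * c + ρ ^ 2 : ℝ) : ℂ) := by
    push_cast
    linear_combination (ρ : ℂ) ^ 2 * hsc - (ρ : ℂ) ^ 2 * s ^ 2 * Complex.I_sq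
  rw [div_sub_div _ _ n1 n2, hprod]
  have hd' : ((1 + 2 * ρ * c + ρ ^ 2 : ℝ) : ℂ) ≠ 0 := by exact_mod_cast hd
  rw [div_eq_iff hd']
  have hreal : (2 * π * (Real.exp (-l * Real.exp x) *
      (s * ρ / (π * (1 + 2 * ρ * c + ρ ^ 2))))) * (1 + 2 * ρ * c + ρ ^ 2) =
      2 * Real.exp (-l * Real.exp x) * (s * ρ) := by
    field_simp
  rw [mul_assoc, ← Complex.ofReal_mul, hreal]
  push_cast
  ring

lemma circle_integral_eq_integral_logKernel {α l : ℝ} (hα0 : 0 < α) (hα1 : α < 1) (hl : 0 < l)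
    (b : ℝ) :
    ∫ θ in (-π)..π, Complex.exp (l * Complex.exp (b + θ * Complex.I)) /
        (1 + Complex.exp (-α * (b + θ * Complex.I))) =
      (2 * π * ∫ x in Set.Iic b, logKernel α l x : ℝ) := by
  have h := integral_halfStrip_boundary
    (fun u => Complex.exp (l * Complex.exp u) / (1 + Complex.exp (-α * u))) b
    (Real.exp (l * Real.exp b) / Real.sin (α * π)) α hα0
    (fun u hu => by
      have := one_add_exp_ne_zero hα0 hα1 hu
      fun_prop (disch := assumption)) ?_
  · simp_rw [logKernel_jump hα0 hα1] at h
    rw [integral_const_mul, integral_complex_ofReal, integral_const_mul] at h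
    exact mul_left_cancel₀ Complex.I_ne_zero h
  · intro u hu hu'
    have hs := sin_mul_pi_pos hα0 hα1
    rw [norm_div, div_mul_eq_mul_div, div_eq_mul_inv, mul_div_assoc]
    refine mul_le_mul (norm_exp_mul_exp_le hl hu) ?_ (by positivity) (Real.exp_pos _).le
    refine (inv_anti₀ (by positivity) (sin_mul_exp_le_norm_one_add_exp hα0 hα1 hu')).trans_eq ?_
    rw [neg_mul, Real.exp_neg]
    field_simp

lemma hasSum_circleKernel {α l b : ℝ} (hα0 : 0 < α) (hl : 0 < l) (hb : 0 < b) :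
    HasSum (fun k : ℕ => (-1 : ℂ) ^ k * circleKernel l (α * k) b)
      (∫ θ in (-π)..π, Complex.exp (l * Complex.exp (b + θ * Complex.I)) /
        (1 + Complex.exp (-α * (b + θ * Complex.I)))) := by
  have hq : Real.exp (-α * b) < 1 := Real.exp_lt_one_iff.2 (by nlinarith)
  have hterm : ∀ (k : ℕ) (u : ℂ), (-1 : ℂ) ^ k * cexpKernel l (α * k) u =
      Complex.exp (l * Complex.exp u) * (-Complex.exp (-α * u)) ^ k := by
    intro k u
    rw [cexpKernel, neg_pow (Complex.exp (-α * u)), ← Complex.exp_nat_mul]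
    have : -((α * k : ℝ) : ℂ) * u = k * (-α * u) := by push_cast; ring
    rw [this]; ring
  have hnorm : ∀ θ : ℝ, ‖-Complex.exp (-α * (b + θ * Complex.I))‖ = Real.exp (-α * b) := by
    intro θ
    rw [norm_neg, Complex.norm_exp]; simp
  simp only [circleKernel, ← intervalIntegral.integral_const_mul]
  refine intervalIntegral.hasSum_integral_of_dominated_convergence
    (fun k _ => Real.exp (l * Real.exp b) * Real.exp (-α * b) ^ k) ?_ ?_ ?_ ?_ ?_
  · intro k
    exact (continuous_const.mul ((differentiable_cexpKernel l _).continuous.comp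
      (by fun_prop))).aestronglyMeasurable
  · refine fun k => ae_of_all _ fun θ _ => ?_
    rw [hterm, norm_mul, norm_pow, hnorm]
    exact mul_le_mul_of_nonneg_right (norm_exp_mul_exp_le hl (by simp)) (by positivity)
  · exact ae_of_all _ fun θ _ =>
      (summable_geometric_of_lt_one (Real.exp_pos _).le hq).mul_left _
  · exact intervalIntegrable_const
  · refine ae_of_all _ fun θ _ => ?_
    simp only [hterm]
    have h := (hasSum_geometric_of_norm_lt_one ((hnorm θ).trans_lt hq)).mul_left
      (Complex.exp (l * Complex.exp (b + θ * Complex.I)))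
    rwa [sub_neg_eq_add, ← div_eq_mul_inv] at h

lemma hasSum_integral_logKernel {α l b : ℝ} (hα0 : 0 < α) (hα1 : α < 1) (hl : 0 < l)
    (hb : 0 < b) :
    HasSum (fun k : ℕ => 2 * π * ((-(l ^ α)) ^ k / Real.Gamma (α * k + 1)) +
        (-1) ^ k * (2 * Real.sin (π * (α * k)) * ∫ x in Set.Ioi b, expKernel l (α * k) x))
      (2 * π * ∫ x in Set.Iic b, logKernel α l x) := by
  have h := hasSum_circleKernel hα0 hl hb
  rw [circle_integral_eq_integral_logKernel hα0 hα1 hl] at h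
  rw [← Complex.hasSum_ofReal]
  refine h.congr_fun ?_
  intro k
  have hk : (0 : ℝ) ≤ α * k := by positivity
  rw [circleKernel_eq hl b (by linarith), neg_pow, ← Real.rpow_mul_natCast hl.le]
  push_cast
  ring

lemma abs_circle_tail_le {α l b : ℝ} (hα0 : 0 < α) (hl : 0 < l) (k : ℕ) :
    |(-1) ^ k * (2 * Real.sin (π * (α * k)) * ∫ x in Set.Ioi b, expKernel l (α * k) x)| ≤
      2 * Real.exp (-b) / l * Real.exp (-α * b) ^ k := by
  have hk : (0 : ℝ) ≤ α * k := by positivity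
  have h0 : 0 ≤ ∫ x in Set.Ioi b, expKernel l (α * k) x :=
    setIntegral_nonneg measurableSet_Ioi fun x _ => (expKernel_pos _ _ _).le
  have h1 := integral_expKernel_Ioi_le hl (s := α * k) (by linarith) b
  have h2 := Real.abs_sin_le_one (π * (α * k))
  have h3 : Real.exp (-(α * k + 1) * b) = Real.exp (-b) * Real.exp (-α * b) ^ k := by
    rw [← Real.exp_nat_mul, ← Real.exp_add]; congr 1; ring
  rw [abs_mul, abs_pow, abs_neg, abs_one, one_pow, one_mul, abs_mul, abs_mul, abs_of_nonneg h0,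
    abs_two]
  calc 2 * |Real.sin (π * (α * k))| * ∫ x in Set.Ioi b, expKernel l (α * k) x
      ≤ 2 * 1 * (Real.exp (-(α * k + 1) * b) / l) := by gcongr
    _ = _ := by rw [h3]; ring

lemma summable_mittagLeffler {α l : ℝ} (hα0 : 0 < α) (hα1 : α < 1) (hl : 0 < l) :
    Summable fun k : ℕ => 2 * π * ((-(l ^ α)) ^ k / Real.Gamma (α * k + 1)) := by
  have hq : Real.exp (-α * 1) < 1 := Real.exp_lt_one_iff.2 (by linarith)
  have ht := Summable.of_norm_bounded (f := fun k : ℕ => (-1) ^ k *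
      (2 * Real.sin (π * (α * k)) * ∫ x in Set.Ioi (1 : ℝ), expKernel l (α * k) x))
    ((summable_geometric_of_lt_one (Real.exp_pos _).le hq).mul_left _)
    (abs_circle_tail_le (b := 1) hα0 hl)
  simpa using (hasSum_integral_logKernel hα0 hα1 hl one_pos).summable.sub ht

lemma abs_integral_logKernel_sub_le {α l b : ℝ} (hα0 : 0 < α) (hα1 : α < 1) (hl : 0 < l)
    (hb : 1 ≤ b) :
    |2 * π * (∫ x in Set.Iic b, logKernel α l x) -
        ∑' k : ℕ, 2 * π * ((-(l ^ α)) ^ k / Real.Gamma (α * k + 1))| ≤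
      2 * Real.exp (-b) / l * (1 - Real.exp (-α))⁻¹ := by
  have hq : Real.exp (-α * b) ≤ Real.exp (-α) := Real.exp_le_exp.2 (by nlinarith)
  have hq1 : Real.exp (-α) < 1 := Real.exp_lt_one_iff.2 (by linarith)
  have h := (hasSum_integral_logKernel (b := b) hα0 hα1 hl (by linarith)).sub
    (summable_mittagLeffler hα0 hα1 hl).hasSum
  simp only [add_sub_cancel_left] at h
  rw [← h.tsum_eq, ← Real.norm_eq_abs]
  refine tsum_of_norm_bounded
    ((hasSum_geometric_of_lt_one (Real.exp_pos _).le hq1).mul_left _) fun k => ?_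
  exact (abs_circle_tail_le hα0 hl k).trans (by gcongr)

open Filter Topology in
/-- For `0 < α < 1` and every `λ > 0`, the Laplace transform of the kernel `K_{α,α}` is
the Mittag-Leffler function `E_α(-λ^α)`. -/
theorem laplace_K_alpha_alpha (α l : ℝ) (hα0 : 0 < α) (hα1 : α < 1) (hl : 0 < l) :
    ∫ r in Set.Ioi (0 : ℝ), Real.exp (-l * r) * ((1 / Real.pi) *
      (r ^ (α - 1) * Real.sin (α * Real.pi)) /
        (r ^ (2 * α) + 2 * r ^ α * Real.cos (α * Real.pi) + 1))
      = ∑' k : ℕ, (-(l ^ α)) ^ k / Real.Gamma (α * k + 1) := by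
  rw [integral_comp_exp_mul]
  change ∫ x, logKernel α l x = _
  have hlim : Tendsto (fun b : ℝ => ∫ x in Set.Iic b, logKernel α l x) atTop
      (𝓝 (∫ x, logKernel α l x)) := by
    have := tendsto_setIntegral_of_monotone (fun b : ℝ => measurableSet_Iic (a := b))
      (fun a b hab => Set.Iic_subset_Iic.2 hab) (integrable_logKernel hα0 hα1 hl).integrableOn
    simpa [Set.iUnion_Iic] using this
  have hlim' : Tendsto (fun b : ℝ => 2 * π * ∫ x in Set.Iic b, logKernel α l x) atTop
      (𝓝 (∑' k : ℕ, 2 * π * ((-(l ^ α)) ^ k / Real.Gamma (α * k + 1)))) := by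
    rw [tendsto_iff_norm_sub_tendsto_zero]
    have h0 : Tendsto (fun b : ℝ => 2 * Real.exp (-b) / l * (1 - Real.exp (-α))⁻¹) atTop (𝓝 0) := by
      simpa using ((Real.tendsto_exp_neg_atTop_nhds_zero.const_mul 2).div_const l).mul_const
        (1 - Real.exp (-α))⁻¹
    refine squeeze_zero' (Eventually.of_forall fun _ => norm_nonneg _) ?_ h0
    filter_upwards [eventually_ge_atTop 1] with b hb
    exact abs_integral_logKernel_sub_le hα0 hα1 hl hb
  have h := tendsto_nhds_unique (hlim.const_mul (2 * π)) hlim'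
  rw [tsum_mul_left] at h
  exact mul_left_cancel₀ (by positivity) h
end

section
/- Let 0 < α < 1 and τ > 0. For every s > 0, the Laplace transform in t of the subordination kernel ψ_{α,α}(t,τ) equals s^{α-1} τ^{α-1} E_{α,α}(-s^α τ^α): ∫_0^∞ e^{-st} · (1/π) · (t^α τ^{α-1} sin(απ)) / (t^{2α} + 2 t^α τ^α cos(απ) + τ^{2α}) dt = s^{α-1} τ^{α-1} ∑_{k=0}^∞ (-s^α τ^α)^k / Γ(αk + α). -/
open Real MeasureTheory

open Set Filter Topology

namespace LaplaceSubordination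

/-- The difference of the boundary values of `g` on the lines `Im w = π` and `Im w = -π`. -/
noncomputable def stripJump (g : ℂ → ℂ) (x : ℝ) : ℂ :=
  g (x + (π : ℝ) * Complex.I) - g (x + (-π : ℝ) * Complex.I)

/-- The integral of `g` along the vertical segment from `a - iπ` to `a + iπ`. -/
noncomputable def stripArc (g : ℂ → ℂ) (a : ℝ) : ℂ :=
  Complex.I * ∫ y in (-π)..π, g (a + y * Complex.I)

/-- The integral of `g` along the contour that comes in from `+∞ - iπ`, crosses the strip
`|Im w| ≤ π` at real part `b`, and returns to `+∞ + iπ`. In the variable `z = exp w` this is a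
Hankel contour of radius `exp b`. -/
noncomputable def hankel (g : ℂ → ℂ) (b : ℝ) : ℂ :=
  stripArc g b + ∫ x in Ioi b, stripJump g x

theorem stripArc_sub_stripArc {g : ℂ → ℂ}
    (hg : DifferentiableOn ℂ g {w | w.im ∈ Icc (-π) π}) (a b : ℝ) :
    stripArc g b - stripArc g a = ∫ x in a..b, stripJump g x := by
  have hcont (y : ℝ) (hy : y ∈ Icc (-π) π) :
      Continuous fun x : ℝ => g (x + y * Complex.I) := by
    refine hg.continuousOn.comp_continuous (by fun_prop) fun x => ?_
    simpa using hy
  have hpi : -π ≤ π := by linarith [pi_pos]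
  have h := Complex.integral_boundary_rect_eq_zero_of_differentiableOn g
    ⟨a, -π⟩ ⟨b, π⟩ (hg.mono fun w hw => by
      have := hw.2
      rwa [uIcc_of_le hpi] at this)
  simp only [smul_eq_mul] at h
  unfold stripJump stripArc
  rw [intervalIntegral.integral_sub ((hcont π ⟨hpi, le_rfl⟩).intervalIntegrable _ _)
    ((hcont (-π) ⟨le_rfl, hpi⟩).intervalIntegrable _ _)]
  linear_combination h

theorem stripArc_eq_add_integral {g : ℂ → ℂ} {l : ℂ} {C : ℝ}
    (hg : DifferentiableOn ℂ g {w | w.im ∈ Icc (-π) π})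
    (hlim : ∀ y : ℝ, Tendsto (fun a : ℝ => g (a + y * Complex.I)) atBot (𝓝 l))
    (hC : ∀ᶠ a : ℝ in atBot, ∀ y : ℝ, ‖g (a + y * Complex.I)‖ ≤ C)
    (hint : Integrable (stripJump g)) (b : ℝ) :
    stripArc g b = 2 * π * Complex.I * l + ∫ x in Iic b, stripJump g x := by
  have hpi : -π ≤ π := by linarith [pi_pos]
  have h1 : Tendsto (fun a => stripArc g a) atBot (𝓝 (2 * π * Complex.I * l)) := by
    have : Tendsto (fun a : ℝ => ∫ y in (-π)..π, g (a + y * Complex.I)) atBot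
        (𝓝 (∫ y in (-π)..π, l)) := by
      refine intervalIntegral.tendsto_integral_filter_of_dominated_convergence (fun _ => C)
        (Eventually.of_forall fun a => ?_) ?_ (by simp)
        (Eventually.of_forall fun y _ => hlim y)
      · rw [uIoc_of_le hpi]
        refine ContinuousOn.aestronglyMeasurable ?_ measurableSet_Ioc
        refine hg.continuousOn.comp (by fun_prop) fun y hy => ?_
        simpa using Ioc_subset_Icc_self hy
      · filter_upwards [hC] with a ha
        exact Eventually.of_forall fun y _ => ha y
    have h2 := this.const_mul Complex.I
    rw [intervalIntegral.integral_const, Complex.real_smul] at h2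
    push_cast at h2
    rwa [show Complex.I * ((π - -π : ℂ) * l) = 2 * π * Complex.I * l by ring] at h2
  have h2 : Tendsto (fun a => ∫ x in a..b, stripJump g x) atBot
      (𝓝 (∫ x in Iic b, stripJump g x)) :=
    intervalIntegral_tendsto_integral_Iic b hint.integrableOn tendsto_id
  have h3 := h1.add h2
  refine tendsto_nhds_unique (tendsto_const_nhds.congr fun a => ?_) h3
  rw [← stripArc_sub_stripArc hg a b]
  ring

theorem hankel_eq_integral {g : ℂ → ℂ} {l : ℂ} {C : ℝ}
    (hg : DifferentiableOn ℂ g {w | w.im ∈ Icc (-π) π})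
    (hlim : ∀ y : ℝ, Tendsto (fun a : ℝ => g (a + y * Complex.I)) atBot (𝓝 l))
    (hC : ∀ᶠ a : ℝ in atBot, ∀ y : ℝ, ‖g (a + y * Complex.I)‖ ≤ C)
    (hint : Integrable (stripJump g)) (b : ℝ) :
    hankel g b = 2 * π * Complex.I * l + ∫ x, stripJump g x := by
  rw [hankel, stripArc_eq_add_integral hg hlim hC hint b, add_assoc,
    intervalIntegral.integral_Iic_add_Ioi hint.integrableOn hint.integrableOn]

theorem integral_Ioi_eq_integral_exp (f : ℝ → ℝ) :
    ∫ t in Ioi 0, f t = ∫ x, exp x * f (exp x) := by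
  have h := integral_image_eq_integral_abs_deriv_smul (f := exp) (f' := exp) MeasurableSet.univ
    (fun x _ => (Real.hasDerivAt_exp x).hasDerivWithinAt) exp_injective.injOn f
  rw [image_univ, range_exp] at h
  simpa [abs_of_pos (exp_pos _)] using h

theorem integrableOn_Ioi_iff_integrable_exp (f : ℝ → ℝ) :
    IntegrableOn f (Ioi 0) ↔ Integrable fun x => exp x * f (exp x) := by
  have h := integrableOn_image_iff_integrableOn_abs_deriv_smul (f := exp) (f' := exp)
    MeasurableSet.univ
    (fun x _ => (Real.hasDerivAt_exp x).hasDerivWithinAt) exp_injective.injOn f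
  rw [image_univ, range_exp] at h
  simpa [abs_of_pos (exp_pos _)] using h

theorem exp_mul_rpow_exp (s β x : ℝ) :
    exp x * (exp x ^ (β - 1) * exp (-s * exp x)) = exp (-s * exp x + β * x) := by
  rw [← exp_mul, ← exp_add, ← exp_add]
  ring_nf

theorem integral_exp_neg_mul_exp {s β : ℝ} (hs : 0 < s) (hβ : 0 < β) :
    ∫ x, exp (-s * exp x + β * x) = s ^ (-β) * Gamma β := by
  simp_rw [← exp_mul_rpow_exp]
  rw [← integral_Ioi_eq_integral_exp fun t => t ^ (β - 1) * exp (-s * t)]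
  simp_rw [neg_mul]
  rw [integral_rpow_mul_exp_neg_mul_Ioi hβ hs, one_div, inv_rpow hs.le, rpow_neg hs.le]

theorem integrable_exp_neg_mul_exp {s β : ℝ} (hs : 0 < s) (hβ : 0 < β) :
    Integrable fun x => exp (-s * exp x + β * x) := by
  simp_rw [← exp_mul_rpow_exp]
  refine (integrableOn_Ioi_iff_integrable_exp fun t => t ^ (β - 1) * exp (-s * t)).1 ?_
  simpa using integrableOn_rpow_mul_exp_neg_mul_rpow (p := 1) (s := β - 1) (b := s)
    (by linarith) one_pos hs

theorem integrableOn_Ioi_exp_neg_mul_exp {s β : ℝ} (hs : 0 < s) (hβ : β ≤ 1) (b : ℝ) :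
    IntegrableOn (fun x => exp (-s * exp x + β * x)) (Ioi b) := by
  refine Integrable.mono' (((integrable_exp_neg_mul_exp hs one_pos).const_mul
    (exp ((β - 1) * b))).integrableOn (s := Ioi b)) (by fun_prop) ?_
  refine (ae_restrict_iff' measurableSet_Ioi).2 (Eventually.of_forall fun x hx => ?_)
  rw [norm_of_nonneg (exp_pos _).le, ← exp_add]
  have : b < x := hx
  exact exp_le_exp.2 (by nlinarith [mul_nonneg (sub_nonneg.2 hβ) (sub_nonneg.2 this.le)])

/-- The integrand `exp (s * z) * z ^ (β - 1) dz` in the variable `z = exp w`. -/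
noncomputable def expKernel (s β : ℝ) (w : ℂ) : ℂ :=
  Complex.exp (s * Complex.exp w + β * w)

theorem differentiable_expKernel (s β : ℝ) : Differentiable ℂ (expKernel s β) := by
  unfold expKernel
  fun_prop

theorem norm_expKernel (s β x y : ℝ) :
    ‖expKernel s β (x + y * Complex.I)‖ = exp (s * (exp x * cos y) + β * x) := by
  rw [expKernel, Complex.norm_exp]
  simp [Complex.exp_re]

theorem norm_expKernel_le {s : ℝ} (hs : 0 < s) (β x y : ℝ) :
    ‖expKernel s β (x + y * Complex.I)‖ ≤ exp (s * exp x + β * x) := by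
  rw [norm_expKernel]
  gcongr
  exact mul_le_of_le_one_right (exp_pos _).le (cos_le_one _)

theorem exp_add_pi_mul_I (x : ℝ) : Complex.exp (x + (π : ℝ) * Complex.I) = -Complex.exp x := by
  simp [Complex.exp_add]

theorem exp_add_neg_pi_mul_I (x : ℝ) :
    Complex.exp (x + (-π : ℝ) * Complex.I) = -Complex.exp x := by
  simp [Complex.exp_add, Complex.exp_neg]

theorem stripJump_expKernel (s β x : ℝ) :
    stripJump (expKernel s β) x =
      (exp (-s * exp x + β * x) : ℝ) * (2 * Complex.I * (sin (β * π) : ℝ)) := by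
  have h : (2 * Complex.I * (sin (β * π) : ℝ)) =
      Complex.exp (β * π * Complex.I) - Complex.exp (-(β * π) * Complex.I) := by
    rw [Complex.exp_mul_I, Complex.exp_mul_I]
    push_cast
    rw [Complex.cos_neg, Complex.sin_neg]
    ring
  rw [stripJump, expKernel, expKernel, exp_add_pi_mul_I, exp_add_neg_pi_mul_I, h, mul_sub]
  push_cast
  rw [← Complex.exp_add, ← Complex.exp_add]
  ring_nf

theorem integrable_stripJump_expKernel {s β : ℝ} (hs : 0 < s) (hβ : 0 < β) :
    Integrable (stripJump (expKernel s β)) := by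
  rw [funext (stripJump_expKernel s β)]
  exact (integrable_exp_neg_mul_exp hs hβ).ofReal.mul_const _

theorem integrableOn_Ioi_stripJump_expKernel {s β : ℝ} (hs : 0 < s) (hβ : β ≤ 1) (b : ℝ) :
    IntegrableOn (stripJump (expKernel s β)) (Ioi b) := by
  rw [funext (stripJump_expKernel s β)]
  exact (integrableOn_Ioi_exp_neg_mul_exp hs hβ b).ofReal.mul_const _

theorem tendsto_exp_mul_atBot {β : ℝ} (hβ : 0 < β) :
    Tendsto (fun x : ℝ => exp (β * x)) atBot (𝓝 0) :=
  tendsto_exp_atBot.comp (tendsto_id.const_mul_atBot hβ)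

theorem tendsto_cexp_mul_atBot {β : ℝ} (hβ : 0 < β) (y : ℝ) :
    Tendsto (fun x : ℝ => Complex.exp (β * (x + y * Complex.I))) atBot (𝓝 0) := by
  rw [tendsto_zero_iff_norm_tendsto_zero]
  simpa [Complex.norm_exp] using tendsto_exp_mul_atBot hβ

theorem tendsto_expKernel_atBot (s : ℝ) {β : ℝ} (hβ : 0 < β) (y : ℝ) :
    Tendsto (fun x : ℝ => expKernel s β (x + y * Complex.I)) atBot (𝓝 0) := by
  have h1 := tendsto_cexp_mul_atBot one_pos y
  have h2 := ((Complex.continuous_exp.tendsto _).comp (h1.const_mul (s : ℂ))).mul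
    (tendsto_cexp_mul_atBot hβ y)
  rw [mul_zero] at h2
  refine h2.congr fun x => ?_
  simp [expKernel, Complex.exp_add]

theorem tendsto_expKernel_zero_atBot (s y : ℝ) :
    Tendsto (fun x : ℝ => expKernel s 0 (x + y * Complex.I)) atBot (𝓝 1) := by
  have h1 := tendsto_cexp_mul_atBot one_pos y
  have h2 := (Complex.continuous_exp.tendsto _).comp (h1.const_mul (s : ℂ))
  rw [mul_zero, Complex.exp_zero] at h2
  refine h2.congr fun x => ?_
  simp [expKernel]

theorem eventually_norm_expKernel_le {s β : ℝ} (hs : 0 < s) (hβ : 0 ≤ β) :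
    ∀ᶠ a : ℝ in atBot, ∀ y : ℝ, ‖expKernel s β (a + y * Complex.I)‖ ≤ exp s := by
  filter_upwards [eventually_le_atBot 0] with a ha y
  refine (norm_expKernel_le hs β a y).trans (exp_le_exp.2 ?_)
  nlinarith [exp_le_one_iff.2 ha, mul_nonpos_of_nonneg_of_nonpos hβ ha]

theorem hankel_expKernel_of_lt_one {s β : ℝ} (hs : 0 < s) (hβ0 : 0 < β) (hβ1 : β < 1) (b : ℝ) :
    hankel (expKernel s β) b = 2 * π * Complex.I * (s ^ (-β) / Gamma (1 - β) : ℝ) := by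
  have hI := integral_ofReal (𝕜 := ℂ) (μ := volume) (f := fun x => exp (-s * exp x + β * x))
  rw [integral_exp_neg_mul_exp hs hβ0] at hI
  rw [hankel_eq_integral (differentiable_expKernel s β).differentiableOn
    (tendsto_expKernel_atBot s hβ0) (eventually_norm_expKernel_le hs hβ0.le)
    (integrable_stripJump_expKernel hs hβ0) b, funext (stripJump_expKernel s β),
    integral_mul_const]
  have h : Gamma β * sin (β * π) = π / Gamma (1 - β) := by
    have hsin : sin (β * π) ≠ 0 :=
      (sin_pos_of_pos_of_lt_pi (by positivity) (by nlinarith [pi_pos])).ne'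
    have hG : Gamma (1 - β) ≠ 0 := (Gamma_pos_of_pos (by linarith)).ne'
    have := Gamma_mul_Gamma_one_sub β
    rw [mul_comm π β] at this
    field_simp at this ⊢
    linear_combination this
  have hmul : s ^ (-β) * Gamma β * sin (β * π) = π * (s ^ (-β) / Gamma (1 - β)) := by
    rw [mul_assoc, h]
    ring
  have hmulC := congrArg (Complex.ofReal) hmul
  rw [Complex.ofReal_mul, Complex.ofReal_mul π] at hmulC
  refine Eq.trans (congrArg (fun z => _ + z * _) hI) ?_
  linear_combination 2 * Complex.I * hmulC

theorem hankel_expKernel_zero {s : ℝ} (hs : 0 < s) (b : ℝ) :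
    hankel (expKernel s 0) b = 2 * π * Complex.I := by
  have hj : stripJump (expKernel s 0) = 0 := by
    ext x
    simp [stripJump_expKernel]
  rw [hankel_eq_integral (differentiable_expKernel s 0).differentiableOn
    (tendsto_expKernel_zero_atBot s) (eventually_norm_expKernel_le hs le_rfl)
    (by rw [hj]; exact integrable_zero _ _ _) b, hj]
  simp

theorem hasDerivAt_expKernel (s β : ℝ) (w : ℂ) :
    HasDerivAt (expKernel s β) (s * expKernel s (β + 1) w + β * expKernel s β w) w := by
  have h := (((Complex.hasDerivAt_exp w).const_mul (s : ℂ)).add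
    ((hasDerivAt_id w).const_mul (β : ℂ))).cexp
  refine h.congr_deriv ?_
  have : expKernel s (β + 1) w = expKernel s β w * Complex.exp w := by
    rw [expKernel, expKernel, ← Complex.exp_add]
    push_cast
    ring_nf
  rw [this]
  simp only [expKernel, Pi.add_apply, id]
  ring

theorem continuous_stripJump_expKernel (s β : ℝ) : Continuous (stripJump (expKernel s β)) := by
  have := (differentiable_expKernel s β).continuous
  unfold stripJump
  fun_prop

theorem tendsto_stripJump_expKernel_atTop {s β : ℝ} (hs : 0 < s) (hβ : β ≤ 0) :
    Tendsto (stripJump (expKernel s β)) atTop (𝓝 0) := by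
  have h : Tendsto (fun x => exp (-s * exp x + β * x)) atTop (𝓝 0) := by
    refine tendsto_exp_atBot.comp ?_
    refine tendsto_atBot_mono' _ ?_ (tendsto_exp_atTop.const_mul_atTop_of_neg (neg_lt_zero.2 hs))
    filter_upwards [eventually_ge_atTop 0] with x hx
    nlinarith [mul_nonpos_of_nonpos_of_nonneg hβ hx]
  rw [funext (stripJump_expKernel s β)]
  simpa using h.ofReal.mul_const (2 * Complex.I * (sin (β * π) : ℝ) : ℂ)

/-- Integration by parts along the Hankel contour. -/
theorem mul_hankel_expKernel_add_one {s β : ℝ} (hs : 0 < s) (hβ : β ≤ 0) (b : ℝ) :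
    s * hankel (expKernel s (β + 1)) b = -β * hankel (expKernel s β) b := by
  have hc (γ : ℝ) : Continuous (expKernel s γ) := (differentiable_expKernel s γ).continuous
  have harc : s * stripArc (expKernel s (β + 1)) b + β * stripArc (expKernel s β) b =
      stripJump (expKernel s β) b := by
    have h (y : ℝ) : HasDerivAt (fun y : ℝ => expKernel s β (b + y * Complex.I))
        ((s * expKernel s (β + 1) (b + y * Complex.I) +
          β * expKernel s β (b + y * Complex.I)) * Complex.I) y := by
      have h1 : HasDerivAt (fun z : ℂ => b + z * Complex.I) Complex.I (y : ℂ) := by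
        simpa using ((hasDerivAt_id (y : ℂ)).mul_const Complex.I).const_add (b : ℂ)
      exact ((hasDerivAt_expKernel s β _).comp (y : ℂ) h1).comp_ofReal
    have h2 := intervalIntegral.integral_eq_sub_of_hasDerivAt (a := -π) (b := π)
      (fun y _ => h y) (Continuous.intervalIntegrable (by fun_prop) _ _)
    rw [intervalIntegral.integral_mul_const, intervalIntegral.integral_add
      (Continuous.intervalIntegrable (by fun_prop) _ _)
      (Continuous.intervalIntegrable (by fun_prop) _ _),
      intervalIntegral.integral_const_mul, intervalIntegral.integral_const_mul] at h2
    rw [stripArc, stripArc, stripJump, ← h2]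
    ring
  have hint1 := (integrableOn_Ioi_stripJump_expKernel hs (β := β + 1) (by linarith) b).const_mul
    (s : ℂ)
  have hint2 := (integrableOn_Ioi_stripJump_expKernel hs (β := β) (by linarith) b).const_mul
    (β : ℂ)
  have hjump : s * (∫ x in Ioi b, stripJump (expKernel s (β + 1)) x) +
      β * (∫ x in Ioi b, stripJump (expKernel s β) x) = -stripJump (expKernel s β) b := by
    have h (x : ℝ) : HasDerivAt (stripJump (expKernel s β))
        (s * stripJump (expKernel s (β + 1)) x + β * stripJump (expKernel s β) x) x := by
      have h1 (y : ℝ) := ((hasDerivAt_expKernel s β _).comp (x : ℂ)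
        ((hasDerivAt_id (x : ℂ)).add_const (y * Complex.I))).comp_ofReal
      refine ((h1 π).sub (h1 (-π))).congr_deriv ?_
      simp only [stripJump, id]
      ring
    have h2 := integral_Ioi_of_hasDerivAt_of_tendsto (a := b)
      (continuous_stripJump_expKernel s β).continuousWithinAt (fun x _ => h x)
      (hint1.add hint2) (tendsto_stripJump_expKernel_atTop hs hβ)
    rw [integral_add hint1 hint2, integral_const_mul, integral_const_mul, zero_sub] at h2
    exact h2
  rw [hankel, hankel]
  linear_combination harc + hjump

/-- Hankel's integral representation of the reciprocal Gamma function. -/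
theorem hankel_expKernel {s c : ℝ} (hs : 0 < s) (hc : 0 < c) (b : ℝ) :
    hankel (expKernel s (1 - c)) b = 2 * π * Complex.I * (s ^ (c - 1) / Gamma c : ℝ) := by
  obtain ⟨n, hn⟩ : ∃ n : ℕ, c ≤ n + 1 := (exists_nat_ge c).imp fun n hn => by linarith
  induction n generalizing c with
  | zero =>
    rw [Nat.cast_zero, zero_add] at hn
    rcases hn.lt_or_eq with h | rfl
    · rw [hankel_expKernel_of_lt_one hs (by linarith) (by linarith)]
      simp
    · simpa using hankel_expKernel_zero hs b
  | succ n ih =>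
    rcases le_or_gt c 1 with h | h
    · exact ih hc (by linarith [n.cast_nonneg (α := ℝ)])
    · have hd : 0 < c - 1 := by linarith
      have h1 := ih hd (by push_cast at hn; linarith)
      have h2 := mul_hankel_expKernel_add_one hs (β := 1 - c) (by linarith) b
      rw [show 1 - c + 1 = 1 - (c - 1) by ring, h1] at h2
      have hd' : ((c - 1 : ℝ) : ℂ) ≠ 0 := by exact_mod_cast hd.ne'
      have h3 : s * (s ^ (c - 1 - 1) / Gamma (c - 1)) = (c - 1) * (s ^ (c - 1) / Gamma c) := by
        have hG := Gamma_add_one hd.ne'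
        rw [sub_add_cancel] at hG
        have := (Gamma_pos_of_pos hd).ne'
        rw [hG, rpow_sub_one hs.ne' (c - 1)]
        field_simp
      have h4 := congrArg Complex.ofReal h3
      rw [Complex.ofReal_mul, Complex.ofReal_mul (c - 1)] at h4
      refine mul_left_cancel₀ hd' ?_
      push_cast at h2 h4 ⊢
      linear_combination -h2 + 2 * π * Complex.I * h4

theorem expKernel_one_sub (s α : ℝ) (k : ℕ) (w : ℂ) :
    expKernel s (1 - α * (k + 1)) w = expKernel s (1 - α) w * Complex.exp (-α * w) ^ k := by
  rw [expKernel, expKernel, ← Complex.exp_nat_mul, ← Complex.exp_add]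
  push_cast
  ring_nf

theorem norm_neg_mul_exp_neg {l : ℝ} (hl : 0 < l) (α x y : ℝ) :
    ‖-(l : ℂ) * Complex.exp (-α * (x + y * Complex.I))‖ = l * exp (-α * x) := by
  rw [norm_mul, norm_neg, Complex.norm_real, norm_of_nonneg hl.le, Complex.norm_exp]
  simp

theorem hasSum_expKernel {l : ℝ} (hl : 0 < l) (s α x y : ℝ) (hx : l * exp (-α * x) < 1) :
    HasSum (fun k : ℕ => (-l : ℂ) ^ k * expKernel s (1 - α * (k + 1)) (x + y * Complex.I))
      (expKernel s 1 (x + y * Complex.I) / (Complex.exp (α * (x + y * Complex.I)) + l)) := by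
  rw [← norm_neg_mul_exp_neg hl α x y] at hx
  set w : ℂ := x + y * Complex.I
  have h := (hasSum_geometric_of_norm_lt_one hx).mul_left (expKernel s (1 - α) w)
  have hexp : Complex.exp (-α * w) * Complex.exp (α * w) = 1 := by
    rw [← Complex.exp_add]
    simp
  have hne : 1 - -(l : ℂ) * Complex.exp (-α * w) ≠ 0 := by
    intro h0
    rw [← sub_eq_zero.1 h0, norm_one] at hx
    exact lt_irrefl _ hx
  have hden : Complex.exp (α * w) + l =
      Complex.exp (α * w) * (1 - -(l : ℂ) * Complex.exp (-α * w)) := by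
    linear_combination -(l : ℂ) * hexp
  have hK : expKernel s 1 w = expKernel s (1 - α) w * Complex.exp (α * w) := by
    rw [expKernel, expKernel, ← Complex.exp_add]
    push_cast
    ring_nf
  have hval : expKernel s 1 w / (Complex.exp (α * w) + l) =
      expKernel s (1 - α) w * (1 - -(l : ℂ) * Complex.exp (-α * w))⁻¹ := by
    rw [hden, hK, mul_comm (Complex.exp (α * w)), mul_div_mul_right _ _ (Complex.exp_ne_zero _),
      div_eq_mul_inv]
  rw [hval]
  refine h.congr_fun fun k => ?_
  rw [expKernel_one_sub, mul_pow]
  ring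

theorem norm_pow_mul_expKernel_le {l q : ℝ} (hl : 0 < l) (s α x y : ℝ) (k : ℕ)
    (hx : l * exp (-α * x) ≤ q) :
    ‖(-l : ℂ) ^ k * expKernel s (1 - α * (k + 1)) (x + y * Complex.I)‖ ≤
      ‖expKernel s (1 - α) (x + y * Complex.I)‖ * q ^ k := by
  rw [expKernel_one_sub, mul_left_comm, ← mul_pow, norm_mul, norm_pow, norm_neg_mul_exp_neg hl]
  gcongr

theorem hasSum_hankel {l s α b : ℝ} (hl : 0 < l) (hs : 0 < s) (hα0 : 0 < α)
    (hb : l * exp (-α * b) < 1) :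
    HasSum (fun k : ℕ => (-l : ℂ) ^ k * hankel (expKernel s (1 - α * (k + 1))) b)
      (hankel (fun w => expKernel s 1 w / (Complex.exp (α * w) + l)) b) := by
  set q := l * exp (-α * b) with hq
  have hq0 : 0 ≤ q := by positivity
  have hqx {x : ℝ} (hx : b ≤ x) : l * exp (-α * x) ≤ q := by
    rw [hq]
    gcongr 1
    exact exp_le_exp.2 (by nlinarith)
  have hc (γ : ℝ) : Continuous (expKernel s γ) := (differentiable_expKernel s γ).continuous
  have hsum := summable_geometric_of_lt_one hq0 hb
  have harc := (intervalIntegral.hasSum_integral_of_dominated_convergence (a := -π) (b := π)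
    (μ := volume)
    (F := fun (k : ℕ) (y : ℝ) =>
      (-l : ℂ) ^ k * expKernel s (1 - α * (k + 1)) (b + y * Complex.I))
    (f := fun y : ℝ => expKernel s 1 (b + y * Complex.I) /
      (Complex.exp (α * (b + y * Complex.I)) + l))
    (fun k _ => exp (s * exp b + (1 - α) * b) * q ^ k)
    (fun k => Continuous.aestronglyMeasurable (by fun_prop))
    (fun k => Eventually.of_forall fun y _ =>
      (norm_pow_mul_expKernel_le hl s α b y k le_rfl).trans
        (by gcongr; exact norm_expKernel_le hs _ _ _))
    (Eventually.of_forall fun y _ => hsum.mul_left _)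
    intervalIntegrable_const
    (Eventually.of_forall fun y _ => hasSum_expKernel hl s α b y hb)).mul_left Complex.I
  have hjump := hasSum_integral_of_dominated_convergence (μ := volume.restrict (Ioi b))
    (F := fun (k : ℕ) (x : ℝ) => (-l : ℂ) ^ k * stripJump (expKernel s (1 - α * (k + 1))) x)
    (f := stripJump fun w => expKernel s 1 w / (Complex.exp (α * w) + l))
    (fun k x => 2 * exp (-s * exp x + (1 - α) * x) * q ^ k)
    (fun k => ((continuous_stripJump_expKernel s _).const_mul _).aestronglyMeasurable)
    (fun k => (ae_restrict_iff' measurableSet_Ioi).2 <| Eventually.of_forall fun x hx => by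
      have h (y : ℝ) (hy : cos y = -1) :
          ‖(-l : ℂ) ^ k * expKernel s (1 - α * (k + 1)) (x + y * Complex.I)‖ ≤
            exp (-s * exp x + (1 - α) * x) * q ^ k := by
        have := norm_pow_mul_expKernel_le hl s α x y k (hqx (le_of_lt hx))
        rw [norm_expKernel s (1 - α), hy] at this
        simpa using this
      rw [stripJump, mul_sub]
      refine (norm_sub_le _ _).trans ?_
      linarith [h π cos_pi, h (-π) (by simp)])
    (Eventually.of_forall fun x => hsum.mul_left _)
    (by
      simp_rw [tsum_mul_left]
      exact ((integrableOn_Ioi_exp_neg_mul_exp hs (by linarith) b).const_mul 2).mul_const _)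
    ((ae_restrict_iff' measurableSet_Ioi).2 <| Eventually.of_forall fun x hx => by
      have hx1 := (hqx (le_of_lt hx)).trans_lt hb
      have h := (hasSum_expKernel hl s α x π hx1).sub (hasSum_expKernel hl s α x (-π) hx1)
      simp_rw [← mul_sub] at h
      exact h)
  refine (harc.add hjump).congr_fun fun k => ?_
  rw [intervalIntegral.integral_const_mul, integral_const_mul, hankel, stripArc]
  ring

theorem rpow_two_mul {x : ℝ} (hx : 0 ≤ x) (a : ℝ) : x ^ (2 * a) = (x ^ a) ^ 2 := by
  rw [← rpow_natCast, ← rpow_mul hx, mul_comm 2 a, Nat.cast_ofNat]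

theorem exp_mul_add_ne_zero {l α : ℝ} (hl : 0 < l) (hα0 : 0 < α) (hα1 : α < 1) {w : ℂ}
    (hw : w.im ∈ Icc (-π) π) : Complex.exp (α * w) + l ≠ 0 := by
  intro h
  have him := congrArg Complex.im h
  have hre := congrArg Complex.re h
  simp only [Complex.add_im, Complex.add_re, Complex.exp_im, Complex.exp_re, Complex.ofReal_im,
    Complex.ofReal_re, Complex.zero_im, Complex.zero_re, Complex.re_ofReal_mul,
    Complex.im_ofReal_mul, add_zero] at him hre
  have hsin : sin (α * w.im) = 0 := (mul_eq_zero.1 him).resolve_left (exp_pos _).ne'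
  have h0 : α * w.im = 0 := (sin_eq_zero_iff_of_lt_of_lt
    (by nlinarith [pi_pos, hw.1]) (by nlinarith [pi_pos, hw.2])).1 hsin
  rw [h0, cos_zero] at hre
  linarith [exp_pos (α * w.re)]

theorem sq_mul_sin_le (l θ A : ℝ) :
    (l * sin θ) ^ 2 ≤ A ^ 2 + 2 * A * l * cos θ + l ^ 2 := by
  nlinarith [sq_nonneg (A + l * cos θ), sin_sq_add_cos_sq θ]

theorem stripJump_expKernel_div {s l α : ℝ} (hl : 0 < l) (hα0 : 0 < α) (hα1 : α < 1) (x : ℝ) :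
    stripJump (fun w => expKernel s 1 w / (Complex.exp (α * w) + l)) x =
      2 * Complex.I * (exp x * (exp (-s * exp x) * (exp x ^ α * sin (α * π) /
        (exp x ^ (2 * α) + 2 * exp x ^ α * l * cos (α * π) + l ^ 2))) : ℝ) := by
  have h1 := exp_mul_add_ne_zero hl hα0 hα1 (w := x + (π : ℝ) * Complex.I)
    (by simpa using pi_pos.le)
  have h2 := exp_mul_add_ne_zero hl hα0 hα1 (w := x + (-π : ℝ) * Complex.I)
    (by simpa using pi_pos.le)
  have hs : 0 < sin (α * π) :=
    sin_pos_of_pos_of_lt_pi (by positivity) (by nlinarith [pi_pos])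
  have hA2 : exp x ^ (2 * α) = (exp x ^ α) ^ 2 := rpow_two_mul (exp_pos x).le α
  have hA : exp x ^ α = exp (α * x) := by rw [← exp_mul, mul_comm]
  have hQ := (pow_pos (mul_pos hl hs) 2).trans_le (sq_mul_sin_le l (α * π) (exp (α * x)))
  have e (y : ℝ) : Complex.exp (α * (x + y * Complex.I)) =
      exp (α * x) * (cos (α * y) + sin (α * y) * Complex.I) := by
    push_cast
    rw [← Complex.exp_mul_I, ← Complex.exp_add]
    ring_nf
  have k1 : expKernel s 1 (x + (π : ℝ) * Complex.I) = -(exp x * exp (-s * exp x) : ℝ) := by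
    rw [expKernel, Complex.exp_add, exp_add_pi_mul_I, Complex.ofReal_one, one_mul,
      exp_add_pi_mul_I]
    push_cast
    ring_nf
  have k2 : expKernel s 1 (x + (-π : ℝ) * Complex.I) = -(exp x * exp (-s * exp x) : ℝ) := by
    rw [expKernel, Complex.exp_add, exp_add_neg_pi_mul_I, Complex.ofReal_one, one_mul,
      exp_add_neg_pi_mul_I]
    push_cast
    ring_nf
  rw [stripJump, k1, k2, hA2, hA]
  rw [e] at h1 h2 ⊢
  rw [e]
  rw [mul_neg α π, cos_neg, sin_neg] at h2 ⊢
  have hcs := congrArg Complex.ofReal (sin_sq_add_cos_sq (α * π))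
  set A := exp (α * x)
  set S := sin (α * π)
  set c := cos (α * π)
  have hQ' : ((A ^ 2 + 2 * A * l * c + l ^ 2 : ℝ) : ℂ) ≠ 0 := by exact_mod_cast hQ.ne'
  have hprod : ((A : ℂ) * (c + S * Complex.I) + l) * (A * (c + (-S : ℝ) * Complex.I) + l) =
      (A ^ 2 + 2 * A * l * c + l ^ 2 : ℝ) := by
    push_cast at hcs ⊢
    linear_combination (A : ℂ) ^ 2 * hcs - (A : ℂ) ^ 2 * S ^ 2 * Complex.I_sq
  rw [div_sub_div _ _ h1 h2, hprod, div_eq_iff hQ']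
  rw [← mul_div_assoc, ← mul_div_assoc, Complex.ofReal_div, mul_assoc, div_mul_cancel₀ _ hQ']
  push_cast
  ring

theorem integral_eq_hankel {s l α : ℝ} (hs : 0 < s) (hl : 0 < l) (hα0 : 0 < α) (hα1 : α < 1)
    (b : ℝ) :
    hankel (fun w => expKernel s 1 w / (Complex.exp (α * w) + l)) b =
      2 * Complex.I * (∫ t in Ioi 0, exp (-s * t) * (t ^ α * sin (α * π) /
        (t ^ (2 * α) + 2 * t ^ α * l * cos (α * π) + l ^ 2)) : ℝ) := by
  have hsin : 0 < sin (α * π) :=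
    sin_pos_of_pos_of_lt_pi (by positivity) (by nlinarith [pi_pos])
  set g : ℂ → ℂ := fun w => expKernel s 1 w / (Complex.exp (α * w) + l) with hg
  have hdiff : DifferentiableOn ℂ g {w | w.im ∈ Icc (-π) π} := by
    refine (differentiable_expKernel s 1).differentiableOn.div (by fun_prop) fun w hw => ?_
    exact exp_mul_add_ne_zero hl hα0 hα1 hw
  have hlim (y : ℝ) : Tendsto (fun a : ℝ => g (a + y * Complex.I)) atBot (𝓝 0) := by
    have h := (tendsto_expKernel_atBot s one_pos y).div
      ((tendsto_cexp_mul_atBot hα0 y).add_const (l : ℂ)) (by simpa using hl.ne')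
    rwa [zero_div] at h
  have hbound : ∀ᶠ a : ℝ in atBot, ∀ y : ℝ, ‖g (a + y * Complex.I)‖ ≤ exp s / (l / 2) := by
    filter_upwards [eventually_norm_expKernel_le hs zero_le_one,
      (tendsto_exp_mul_atBot hα0).eventually_le_const (half_pos hl)] with a h1 h2 y
    have h3 : l / 2 ≤ ‖Complex.exp (α * (a + y * Complex.I)) + l‖ := by
      have h4 := norm_sub_norm_le (l : ℂ) (-Complex.exp (α * (a + y * Complex.I)))
      rw [sub_neg_eq_add, norm_neg, Complex.norm_exp, Complex.norm_real, norm_of_nonneg hl.le,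
        add_comm (l : ℂ)] at h4
      simp only [Complex.add_re, Complex.ofReal_re, Complex.mul_re,
        Complex.I_re, mul_zero, Complex.ofReal_im, zero_mul, sub_zero, add_zero] at h4
      linarith
    rw [hg, norm_div]
    have := h1 y
    gcongr
  set F : ℝ → ℝ := fun x => exp x * (exp (-s * exp x) * (exp x ^ α * sin (α * π) /
    (exp x ^ (2 * α) + 2 * exp x ^ α * l * cos (α * π) + l ^ 2)))
  have hjump : stripJump g = fun x => 2 * Complex.I * (F x : ℂ) :=
    funext (stripJump_expKernel_div hl hα0 hα1)
  have hF : Integrable F := by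
    refine Integrable.mono' ((integrable_exp_neg_mul_exp hs (β := 1 + α) (by linarith)).mul_const
      (sin (α * π) / (l * sin (α * π)) ^ 2)) (by fun_prop) (Eventually.of_forall fun x => ?_)
    have hA2 : exp x ^ (2 * α) = (exp x ^ α) ^ 2 := by
      rw [← rpow_natCast, ← rpow_mul (exp_pos x).le, mul_comm 2 α]
      norm_num
    have hE : exp (-s * exp x + (1 + α) * x) = exp x * (exp (-s * exp x) * exp x ^ α) := by
      rw [← exp_mul, ← exp_add, ← exp_add]
      ring_nf
    have hQ := sq_mul_sin_le l (α * π) (exp x ^ α)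
    have hP : 0 < (l * sin (α * π)) ^ 2 := by positivity
    have hQ0 := hP.trans_le hQ
    simp only [F]
    rw [hA2, norm_of_nonneg (by positivity), hE, mul_div_assoc, ← mul_assoc, ← mul_assoc,
      ← mul_assoc]
    gcongr
  have hint : Integrable (stripJump g) := by
    rw [hjump]
    exact hF.ofReal.const_mul _
  rw [hankel_eq_integral hdiff hlim hbound hint b, hjump, integral_const_mul,
    integral_Ioi_eq_integral_exp, mul_zero, zero_add]
  exact congrArg _ integral_ofReal

/-- The Laplace transform of the imaginary part of the resolvent-type kernel `1 / (z ^ α + l)` on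
the branch cut. -/
theorem hasSum_laplace {s l α : ℝ} (hs : 0 < s) (hl : 0 < l) (hα0 : 0 < α) (hα1 : α < 1) :
    HasSum (fun k : ℕ => π * ((-l) ^ k * (s ^ (α * k + α - 1) / Gamma (α * k + α))))
      (∫ t in Ioi 0, exp (-s * t) * (t ^ α * sin (α * π) /
        (t ^ (2 * α) + 2 * t ^ α * l * cos (α * π) + l ^ 2))) := by
  obtain ⟨b, hb⟩ : ∃ b : ℝ, l * exp (-α * b) < 1 := by
    have h := ((tendsto_exp_mul_atBot hα0).const_mul l).eventually_lt_const
      (u := 1) (by simp)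
    obtain ⟨b, hb⟩ := h.exists
    exact ⟨-b, by simpa using hb⟩
  have h := (hasSum_hankel hl hs hα0 hb).mul_left (2 * Complex.I)⁻¹
  rw [integral_eq_hankel hs hl hα0 hα1, inv_mul_cancel_left₀ (by simp)] at h
  rw [← Complex.hasSum_ofReal]
  refine h.congr_fun fun k => ?_
  rw [hankel_expKernel hs (by positivity), show α * ((k : ℝ) + 1) = α * k + α by ring]
  push_cast
  field_simp

end LaplaceSubordination

/-- For `0 < α < 1`, `τ > 0` and every `s > 0`, the Laplace transform in `t` of the
subordination kernel `ψ_{α,α}(t,τ)` equals `s^{α-1} τ^{α-1} E_{α,α}(-s^α τ^α)`. -/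
theorem laplace_psi_alpha_alpha (α τ s : ℝ) (hα0 : 0 < α) (hα1 : α < 1)
    (hτ : 0 < τ) (hs : 0 < s) :
    ∫ t in Set.Ioi (0 : ℝ), Real.exp (-s * t) * ((1 / Real.pi) *
      (t ^ α * τ ^ (α - 1) * Real.sin (α * Real.pi)) /
        (t ^ (2 * α) + 2 * t ^ α * τ ^ α * Real.cos (α * Real.pi) + τ ^ (2 * α)))
      = s ^ (α - 1) * τ ^ (α - 1) *
          ∑' k : ℕ, (-(s ^ α * τ ^ α)) ^ k / Real.Gamma (α * k + α) := by
  have hτ2 : τ ^ (2 * α) = (τ ^ α) ^ 2 :=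
    LaplaceSubordination.rpow_two_mul hτ.le α
  have h := LaplaceSubordination.hasSum_laplace hs (rpow_pos_of_pos hτ α) hα0 hα1
  have hterm (k : ℕ) : π * ((-τ ^ α) ^ k * (s ^ (α * k + α - 1) / Gamma (α * k + α))) =
      π * s ^ (α - 1) * ((-(s ^ α * τ ^ α)) ^ k / Gamma (α * k + α)) := by
    rw [← mul_neg, mul_pow, ← rpow_natCast (s ^ α), ← rpow_mul hs.le, add_sub_assoc,
      rpow_add hs]
    ring
  simp_rw [hterm] at h
  calc
    _ = ∫ t in Ioi (0 : ℝ), τ ^ (α - 1) / π * (exp (-s * t) * (t ^ α * sin (α * π) /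
        (t ^ (2 * α) + 2 * t ^ α * τ ^ α * cos (α * π) + (τ ^ α) ^ 2))) := by
      rw [hτ2]
      congr 1 with t
      ring
    _ = _ := by
      rw [integral_const_mul, ← h.tsum_eq, tsum_mul_left]
      field_simp
end

section
/- Let 0 < α < 1, τ > 0, and set θ₀ = min((1-α)π/α, π/2). The complex function Ψ(t) = (1/π) · t^α τ^{α-1} sin(απ) / (t^{2α} + 2 t^α τ^α cos(απ) + τ^{2α}), where t^α = exp(α Log t) with the principal branch of the logarithm, is well defined (the denominator is nonzero) and analytic on the open sector {t ∈ ℂ \ {0} : |arg t| < θ₀}, and for every θ with 0 < θ < θ₀ it is bounded on the subsector {t ∈ ℂ \ {0} : |arg t| ≤ θ}. -/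
open Real Complex Set

/-- Law of cosines for complex numbers in polar form. -/
lemma sq_norm_polar_add_polar (r s φ ψ : ℝ) :
    ‖(r : ℂ) * cexp (φ * I) + (s : ℂ) * cexp (ψ * I)‖ ^ 2
      = r ^ 2 + s ^ 2 + 2 * r * s * Real.cos (φ - ψ) := by
  rw [Complex.sq_norm, Complex.normSq_apply]
  simp only [add_re, add_im, re_ofReal_mul, im_ofReal_mul, exp_ofReal_mul_I_re,
    exp_ofReal_mul_I_im]
  rw [Real.cos_sub]
  linear_combination r ^ 2 * Real.sin_sq_add_cos_sq φ + s ^ 2 * Real.sin_sq_add_cos_sq ψ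

/-- If the angle between two complex numbers is at most `β ≤ π`, the square of the norm of their
sum is bounded below by a multiple of the square of the sum of their norms. -/
lemma le_sq_norm_polar_add_polar {r s φ ψ β : ℝ} (hr : 0 ≤ r) (hs : 0 ≤ s)
    (h : |φ - ψ| ≤ β) (hβ : β ≤ Real.pi) :
    (1 + Real.cos β) / 2 * (r + s) ^ 2
      ≤ ‖(r : ℂ) * cexp (φ * I) + (s : ℂ) * cexp (ψ * I)‖ ^ 2 := by
  rw [sq_norm_polar_add_polar, ← Real.cos_abs (φ - ψ)]
  have hc := Real.cos_le_cos_of_nonneg_of_le_pi (abs_nonneg _) hβ h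
  nlinarith [mul_le_mul_of_nonneg_left hc (mul_nonneg hr hs),
    mul_nonneg (sub_nonneg.2 (Real.cos_le_one β)) (sq_nonneg (r - s))]

/-- The denominator of the subordination kernel is a product of two linear factors in `t ^ α`. -/
lemma subordination_denominator_eq_mul (z s : ℂ) (γ : ℝ) :
    z ^ 2 + 2 * z * s * (Real.cos γ : ℂ) + s ^ 2
      = (z + s * cexp ((γ : ℝ) * I)) * (z + s * cexp ((-γ : ℝ) * I)) := by
  simp only [exp_mul_I, ofReal_neg, Complex.cos_neg, Complex.sin_neg, ofReal_cos]
  linear_combination (-s ^ 2) * Complex.sin_sq_add_cos_sq γ + s ^ 2 * Complex.sin γ ^ 2 * I_sq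

/-- Lower bound for the denominator of the subordination kernel on a sector. -/
lemma le_norm_subordination_denominator {α τ θ : ℝ} (hα : 0 < α) (hτ : 0 < τ)
    (hθ : α * (θ + Real.pi) ≤ Real.pi) {t : ℂ} (ht : t ≠ 0) (harg : |t.arg| ≤ θ) :
    2 * (1 + Real.cos (α * (θ + Real.pi))) * (‖t‖ ^ α * τ ^ α) ≤
      ‖t ^ (2 * α : ℂ) + 2 * t ^ (α : ℂ) * (τ : ℂ) ^ (α : ℂ) * (Real.cos (α * Real.pi) : ℂ)
        + (τ : ℂ) ^ (2 * α : ℂ)‖ := by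
  set β := α * (θ + Real.pi) with hβ
  have hpow (w : ℂ) : w ^ (2 * α : ℂ) = (w ^ (α : ℂ)) ^ 2 := by
    exact_mod_cast Complex.cpow_nat_mul w 2 α
  have hs : (τ : ℂ) ^ (α : ℂ) = ((τ ^ α : ℝ) : ℂ) := (ofReal_cpow hτ.le α).symm
  have hz : t ^ (α : ℂ) = ((‖t‖ ^ α : ℝ) : ℂ) * cexp ((α * t.arg : ℝ) * I) := by
    rw [cpow_def_of_ne_zero ht, Complex.log, Real.rpow_def_of_pos (norm_pos_iff.2 ht),
      ofReal_exp, ← Complex.exp_add]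
    push_cast
    ring_nf
  have hangle (γ : ℝ) (hγ : |γ| = α * Real.pi) : |α * t.arg - γ| ≤ β := by
    calc |α * t.arg - γ| ≤ |α * t.arg| + |γ| := abs_sub _ _
      _ = α * |t.arg| + α * Real.pi := by rw [abs_mul, abs_of_pos hα, hγ]
      _ ≤ β := by rw [hβ, mul_add]; gcongr
  have hαπ : |α * Real.pi| = α * Real.pi := abs_of_pos (by positivity)
  rw [hpow, hpow, hs, subordination_denominator_eq_mul, norm_mul, hz]
  have hr0 : 0 ≤ ‖t‖ ^ α := by positivity
  have hs0 : 0 ≤ τ ^ α := by positivity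
  have h1 := le_sq_norm_polar_add_polar hr0 hs0 (hangle _ hαπ) hθ
  have h2 := le_sq_norm_polar_add_polar hr0 hs0 (hangle _ ((abs_neg _).trans hαπ)) hθ
  have hc : 0 ≤ 1 + Real.cos β := by linarith [Real.neg_one_le_cos β]
  calc 2 * (1 + Real.cos β) * (‖t‖ ^ α * τ ^ α)
      ≤ (1 + Real.cos β) / 2 * (‖t‖ ^ α + τ ^ α) ^ 2 := by
        nlinarith [mul_nonneg hc (sq_nonneg (‖t‖ ^ α - τ ^ α))]
    _ ≤ _ := by
        refine le_of_sq_le_sq ?_ (mul_nonneg (norm_nonneg _) (norm_nonneg _))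
        rw [mul_pow ‖_‖, sq ((1 + Real.cos β) / 2 * _)]
        exact mul_le_mul h1 h2 (by positivity) (by positivity)

/-- For `0 < α < 1`, `τ > 0` and `θ₀ = min((1-α)π/α, π/2)`, the complex extension
`Ψ(t) = (1/π) t^α τ^{α-1} sin(απ) / (t^{2α} + 2 t^α τ^α cos(απ) + τ^{2α})`
(with the principal branch power) has nonvanishing denominator and is analytic on the
open sector `|arg t| < θ₀`, and is bounded on every closed subsector `|arg t| ≤ θ < θ₀`. -/
theorem psi_alpha_alpha_analytic_sector (α τ : ℝ) (hα0 : 0 < α) (hα1 : α < 1)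
    (hτ : 0 < τ) (θ₀ : ℝ) (hθ₀ : θ₀ = min ((1 - α) * Real.pi / α) (Real.pi / 2)) :
    (∀ t : ℂ, t ≠ 0 → |t.arg| < θ₀ →
      t ^ (2 * α : ℂ) + 2 * t ^ (α : ℂ) * (τ : ℂ) ^ (α : ℂ) * (Real.cos (α * Real.pi) : ℂ)
        + (τ : ℂ) ^ (2 * α : ℂ) ≠ 0) ∧
    AnalyticOn ℂ
      (fun t : ℂ =>
        (1 / (Real.pi : ℂ)) *
          (t ^ (α : ℂ) * (τ : ℂ) ^ ((α : ℂ) - 1) * (Real.sin (α * Real.pi) : ℂ)) /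
          (t ^ (2 * α : ℂ) + 2 * t ^ (α : ℂ) * (τ : ℂ) ^ (α : ℂ) * (Real.cos (α * Real.pi) : ℂ)
            + (τ : ℂ) ^ (2 * α : ℂ)))
      {t : ℂ | t ≠ 0 ∧ |t.arg| < θ₀} ∧
    ∀ θ : ℝ, 0 < θ → θ < θ₀ → ∃ C : ℝ, ∀ t : ℂ, t ≠ 0 → |t.arg| ≤ θ →
      ‖(1 / (Real.pi : ℂ)) *
          (t ^ (α : ℂ) * (τ : ℂ) ^ ((α : ℂ) - 1) * (Real.sin (α * Real.pi) : ℂ)) /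
          (t ^ (2 * α : ℂ) + 2 * t ^ (α : ℂ) * (τ : ℂ) ^ (α : ℂ) * (Real.cos (α * Real.pi) : ℂ)
            + (τ : ℂ) ^ (2 * α : ℂ))‖ ≤ C := by
  have hβ {θ : ℝ} (hθ : θ < θ₀) : α * (θ + Real.pi) < Real.pi := by
    have h := hθ.trans_le (hθ₀.trans_le (min_le_left _ _))
    rw [lt_div_iff₀ hα0] at h
    linarith
  have hcos {θ : ℝ} (h0 : 0 ≤ θ) (hθ : θ < θ₀) : 0 < 1 + Real.cos (α * (θ + Real.pi)) := by
    have h := Real.cos_lt_cos_of_nonneg_of_le_pi (by positivity) le_rfl (hβ hθ)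
    rw [Real.cos_pi] at h
    linarith
  have hne (t : ℂ) (ht : t ≠ 0) (harg : |t.arg| < θ₀) :
      t ^ (2 * α : ℂ) + 2 * t ^ (α : ℂ) * (τ : ℂ) ^ (α : ℂ) * (Real.cos (α * Real.pi) : ℂ)
        + (τ : ℂ) ^ (2 * α : ℂ) ≠ 0 := by
    refine norm_pos_iff.1 (lt_of_lt_of_le ?_
      (le_norm_subordination_denominator hα0 hτ (hβ harg).le ht le_rfl))
    have := hcos (abs_nonneg _) harg
    have := norm_pos_iff.2 ht
    positivity
  refine ⟨hne, AnalyticOnNhd.analyticOn fun t ⟨ht, harg⟩ ↦ ?_, fun θ h0 hθ ↦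
    ⟨1 / Real.pi * (‖(τ : ℂ) ^ ((α : ℂ) - 1)‖ * ‖(Real.sin (α * Real.pi) : ℂ)‖) /
      (2 * (1 + Real.cos (α * (θ + Real.pi))) * τ ^ α), fun t ht harg ↦ ?_⟩⟩
  · have hslit : t ∈ slitPlane := by
      refine mem_slitPlane_iff_arg.2 ⟨fun h ↦ ?_, ht⟩
      have hlt := harg.trans_le (hθ₀.trans_le (min_le_right _ _))
      rw [h, abs_of_pos Real.pi_pos] at hlt
      linarith [Real.pi_pos]
    have hpow (c : ℂ) : AnalyticAt ℂ (fun t : ℂ ↦ t ^ c) t :=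
      analyticAt_id.cpow analyticAt_const hslit
    have h1 := hpow α
    have h2 := hpow (2 * α)
    exact AnalyticAt.fun_div (by fun_prop) (by fun_prop) (hne t ht harg)
  · have hden := le_norm_subordination_denominator hα0 hτ (hβ hθ).le ht harg
    have hc := hcos h0.le hθ
    have ht0 := norm_pos_iff.2 ht
    have hr : 0 < ‖t‖ ^ α := by positivity
    have hz : ‖t ^ (α : ℂ)‖ = ‖t‖ ^ α := norm_cpow_real t α
    have hπ : ‖(1 / (Real.pi : ℂ))‖ = 1 / Real.pi := by
      rw [norm_div, norm_one, Complex.norm_of_nonneg Real.pi_pos.le]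
    rw [norm_div, norm_mul, norm_mul, norm_mul, hz, hπ]
    calc _ ≤ 1 / Real.pi * (‖t‖ ^ α * ‖(τ : ℂ) ^ ((α : ℂ) - 1)‖ *
            ‖(Real.sin (α * Real.pi) : ℂ)‖) /
          (2 * (1 + Real.cos (α * (θ + Real.pi))) * (‖t‖ ^ α * τ ^ α)) := by
          gcongr
      _ = _ := by
          field_simp
end

section
/- Let n ≥ 1 be a natural number, x ∈ ℝⁿ with x ≠ 0, and t > 0. Then the subordinated Green function for α = β = 1/2 is given by a Tricomi confluent hypergeometric integral: (√t / π) ∫_0^∞ (1/(√τ (t + τ))) · (4πτ)^{-n/2} e^{-|x|²/(4τ)} dτ = (1 / (2^n π^{n/2+1} t^{n/2})) ∫_0^∞ ξ^{(n-1)/2} (1 + ξ)^{-1} e^{-(|x|²/(4t)) ξ} dξ. -/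
open Real MeasureTheory

/-- The change of variables `τ = t / ξ` on the positive half-line. -/
lemma integral_Ioi_eq_integral_comp_mul_inv (f : ℝ → ℝ) {t : ℝ} (ht : 0 < t) :
    ∫ τ in Set.Ioi (0 : ℝ), f τ =
      ∫ ξ in Set.Ioi (0 : ℝ), t * (ξ ^ 2)⁻¹ * f (t * ξ⁻¹) := by
  have h1 := integral_comp_mul_left_Ioi' f 0 ht
  rw [mul_zero, ← integral_comp_rpow_Ioi (fun y => f (t * y)) (by norm_num : (-1 : ℝ) ≠ 0),
    smul_eq_mul, ← integral_const_mul] at h1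
  rw [← h1]
  refine setIntegral_congr_fun measurableSet_Ioi fun ξ hξ => ?_
  have hξ' : (0 : ℝ) < ξ := hξ
  have h2 : ξ ^ ((-1 : ℝ) - 1) = (ξ ^ 2)⁻¹ := by
    rw [show (-1 : ℝ) - 1 = -(2 : ℕ) by norm_num, rpow_neg hξ'.le, rpow_natCast]
  simp only [smul_eq_mul, h2, rpow_neg_one, abs_neg, abs_one, one_mul, mul_assoc]

/-- The normalising factor of the heat kernel at time `t / ξ`. -/
lemma four_pi_mul_rpow_neg_half (n : ℕ) {t ξ : ℝ} (ht : 0 < t) (hξ : 0 < ξ) :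
    (4 * π * (t * ξ⁻¹)) ^ (-(n : ℝ) / 2) =
      ξ ^ ((n : ℝ) / 2) / (2 ^ n * π ^ ((n : ℝ) / 2) * t ^ ((n : ℝ) / 2)) := by
  have h4 : (4 : ℝ) ^ ((n : ℝ) / 2) = 2 ^ n := by
    rw [show (4 : ℝ) = 2 ^ (2 : ℝ) by norm_num, ← rpow_mul (by norm_num),
      mul_div_cancel₀ _ (by norm_num), rpow_natCast]
  rw [neg_div, rpow_neg (by positivity), mul_rpow (by positivity) (by positivity),
    mul_rpow (by norm_num) pi_pos.le, mul_rpow ht.le (by positivity), inv_rpow hξ.le, h4]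
  field_simp

/-- For `n ≥ 1`, `x ∈ ℝⁿ` nonzero and `t > 0`, the subordinated Green function for
`α = β = 1/2` is given by a Tricomi confluent hypergeometric integral. -/
theorem green_half_tricomi (n : ℕ) (hn : 1 ≤ n) (x : EuclideanSpace ℝ (Fin n))
    (hx : x ≠ 0) (t : ℝ) (ht : 0 < t) :
    (Real.sqrt t / Real.pi) *
      ∫ τ in Set.Ioi (0 : ℝ),
        (1 / (Real.sqrt τ * (t + τ))) * (4 * Real.pi * τ) ^ (-(n : ℝ) / 2) *
          Real.exp (-‖x‖ ^ 2 / (4 * τ))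
      = (1 / (2 ^ n * Real.pi ^ ((n : ℝ) / 2 + 1) * t ^ ((n : ℝ) / 2))) *
          ∫ ξ in Set.Ioi (0 : ℝ),
            ξ ^ (((n : ℝ) - 1) / 2) * (1 + ξ)⁻¹ * Real.exp (-(‖x‖ ^ 2 / (4 * t)) * ξ) := by
  rw [integral_Ioi_eq_integral_comp_mul_inv _ ht, ← integral_const_mul, ← integral_const_mul]
  refine setIntegral_congr_fun measurableSet_Ioi fun ξ hξ => ?_
  have hξ' : (0 : ℝ) < ξ := hξ
  have hexp : -‖x‖ ^ 2 / (4 * (t * ξ⁻¹)) = -(‖x‖ ^ 2 / (4 * t)) * ξ := by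
    field_simp
  have hpow : ξ ^ (((n : ℝ) - 1) / 2) = ξ ^ ((n : ℝ) / 2) / √ξ := by
    rw [sub_div, rpow_sub hξ', sqrt_eq_rpow]
  have hpi : π ^ ((n : ℝ) / 2 + 1) = π ^ ((n : ℝ) / 2) * π := by
    rw [rpow_add pi_pos, rpow_one]
  have hsqrt : √(t * ξ⁻¹) = √t / √ξ := by
    rw [sqrt_mul ht.le, sqrt_inv, div_eq_mul_inv]
  have hξs : √ξ ^ 2 = ξ := sq_sqrt hξ'.le
  have hξ0 : 0 < √ξ := sqrt_pos.2 hξ'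
  have ht0 : 0 < √t := sqrt_pos.2 ht
  simp only [hexp, four_pi_mul_rpow_neg_half n ht hξ', hpow, hpi, hsqrt]
  generalize rexp (-(‖x‖ ^ 2 / (4 * t)) * ξ) = E
  field_simp
  rw [hξs]
  field_simp
  ring
end

section
/- For every x ∈ ℝ with x ≠ 0 and every t > 0, the one-dimensional Green function with α = β = 1/2 is given in terms of the exponential integral: (√t / π) ∫_0^∞ e^{-x²/(4τ)} / (√τ (t + τ) √(4πτ)) dτ = (1 / (2 π^{3/2} √t)) · e^{x²/(4t)} · ∫_{x²/(4t)}^∞ (e^{-ξ} / ξ) dξ. -/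
open Real MeasureTheory

/-- The image of the positive half-line under `τ ↦ c + b / τ`. -/
lemma image_add_div_Ioi {b : ℝ} (hb : 0 < b) (c : ℝ) :
    (fun τ : ℝ => c + b / τ) '' Set.Ioi 0 = Set.Ioi c := by
  ext ξ
  simp only [Set.mem_image, Set.mem_Ioi]
  constructor
  · rintro ⟨τ, hτ, rfl⟩
    have := div_pos hb hτ
    linarith
  · intro hξ
    have h : 0 < ξ - c := sub_pos.mpr hξ
    exact ⟨b / (ξ - c), div_pos hb h, by field_simp; ring⟩

/-- The exponential integral `E₁ (b / t)` as an integral over the positive half-line, through the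
substitution `ξ = b / t + b / τ`. -/
lemma integral_exp_neg_div_Ioi {b t : ℝ} (hb : 0 < b) (ht : 0 < t) :
    ∫ ξ in Set.Ioi (b / t), exp (-ξ) / ξ =
      t * exp (-(b / t)) * ∫ τ in Set.Ioi (0 : ℝ), exp (-(b / τ)) / (τ * (t + τ)) := by
  have hderiv : ∀ τ ∈ Set.Ioi (0 : ℝ),
      HasDerivWithinAt (fun τ : ℝ => b / t + b / τ) (-b / τ ^ 2) (Set.Ioi 0) τ := by
    intro τ hτ
    have h := ((hasDerivAt_inv (ne_of_gt hτ)).const_mul b).const_add (b / t)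
    exact (h.congr_deriv (by ring)).hasDerivWithinAt
  have hinj : Set.InjOn (fun τ : ℝ => b / t + b / τ) (Set.Ioi 0) := by
    intro τ _ σ _ h
    exact inv_injective (mul_left_cancel₀ hb.ne' (add_left_cancel h))
  rw [← image_add_div_Ioi hb (b / t),
    integral_image_eq_integral_abs_deriv_smul measurableSet_Ioi hderiv hinj,
    ← integral_const_mul]
  refine setIntegral_congr_fun measurableSet_Ioi fun τ hτ => ?_
  have hτ : 0 < τ := hτ
  have habs : |-b / τ ^ 2| = b / τ ^ 2 := by
    rw [neg_div, abs_neg, abs_of_pos (by positivity)]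
  simp only [habs, smul_eq_mul, neg_add, Real.exp_add]
  field_simp
  ring

/-- For every real `x ≠ 0` and `t > 0`, the one-dimensional Green function with
`α = β = 1/2` is given in terms of the exponential integral. -/
theorem green_half_1d (x t : ℝ) (hx : x ≠ 0) (ht : 0 < t) :
    (Real.sqrt t / Real.pi) *
      ∫ τ in Set.Ioi (0 : ℝ),
        Real.exp (-x ^ 2 / (4 * τ)) / (Real.sqrt τ * (t + τ) * Real.sqrt (4 * Real.pi * τ))
      = (1 / (2 * Real.pi ^ (3 / 2 : ℝ) * Real.sqrt t)) * Real.exp (x ^ 2 / (4 * t)) *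
          ∫ ξ in Set.Ioi (x ^ 2 / (4 * t)), Real.exp (-ξ) / ξ := by
  have hb : 0 < x ^ 2 / 4 := by positivity
  have hkernel : ∫ τ in Set.Ioi (0 : ℝ), exp (-x ^ 2 / (4 * τ)) / (√τ * (t + τ) * √(4 * π * τ)) =
      1 / (2 * √π) * ∫ τ in Set.Ioi (0 : ℝ), exp (-(x ^ 2 / 4 / τ)) / (τ * (t + τ)) := by
    rw [← integral_const_mul]
    refine setIntegral_congr_fun measurableSet_Ioi fun τ hτ => ?_
    have hτ : 0 < τ := hτ
    have hsqrt : √τ * (t + τ) * √(4 * π * τ) = 2 * √π * (τ * (t + τ)) := by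
      rw [Real.sqrt_mul (by positivity), Real.sqrt_mul (by norm_num),
        show √(4 : ℝ) = 2 by rw [Real.sqrt_eq_iff_mul_self_eq] <;> norm_num]
      linear_combination 2 * √π * (t + τ) * Real.mul_self_sqrt hτ.le
    simp only [hsqrt]
    rw [neg_div, ← div_div (x ^ 2) 4 τ]
    field_simp
  have hpi : π ^ (3 / 2 : ℝ) = π * √π := by
    rw [Real.sqrt_eq_rpow, show (3 / 2 : ℝ) = 1 + 1 / 2 by norm_num, Real.rpow_add pi_pos,
      Real.rpow_one]
  rw [hkernel, ← div_div (x ^ 2) 4 t, integral_exp_neg_div_Ioi hb ht, hpi, Real.exp_neg (x ^ 2 / 4 / t)]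
  field_simp
  rw [Real.sq_sqrt ht.le]
end

section
/- Fix t > 0 and let G(x) = (√t / π) ∫_0^∞ e^{-x²/(4τ)} / (√τ (t + τ) √(4πτ)) dτ for x > 0. Then G(x) is asymptotically equivalent to 2√t / (π^{3/2} x²) as x → +∞; that is, lim_{x→+∞} G(x) · π^{3/2} x² / (2√t) = 1. -/
open Real MeasureTheory Filter

lemma exp_inv_div_sq_eq_comp_rpow {v : ℝ} (hv : v ∈ Set.Ioi (0 : ℝ)) :
    (|(-1 : ℝ)| * v ^ ((-1 : ℝ) - 1)) • exp (-(1 / 4) * v ^ (-1 : ℝ)) =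
      exp (-1 / (4 * v)) / v ^ 2 := by
  have hv0 : 0 < v := hv
  have h : v ^ ((-1 : ℝ) - 1) = (v ^ 2)⁻¹ := by
    rw [show (-1 : ℝ) - 1 = -((2 : ℕ) : ℝ) by norm_num, rpow_neg hv0.le, rpow_natCast]
  have hexp : -(1 / 4) * v⁻¹ = -1 / (4 * v) := by field_simp
  rw [h, rpow_neg_one, hexp, abs_neg, abs_one, one_mul, smul_eq_mul, inv_mul_eq_div]

lemma integrableOn_exp_inv_div_sq :
    IntegrableOn (fun v : ℝ => exp (-1 / (4 * v)) / v ^ 2) (Set.Ioi 0) :=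
  ((integrableOn_Ioi_comp_rpow_iff (fun u : ℝ => exp (-(1 / 4) * u))
    (by norm_num : (-1 : ℝ) ≠ 0)).2 (integrableOn_exp_mul_Ioi (by norm_num) 0)).congr_fun
    (fun _ hv => exp_inv_div_sq_eq_comp_rpow hv) measurableSet_Ioi

lemma integral_exp_inv_div_sq :
    ∫ v in Set.Ioi (0 : ℝ), exp (-1 / (4 * v)) / v ^ 2 = 4 := by
  rw [← setIntegral_congr_fun measurableSet_Ioi (fun _ hv => exp_inv_div_sq_eq_comp_rpow hv),
    integral_comp_rpow_Ioi (fun u : ℝ => exp (-(1 / 4) * u)) (by norm_num),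
    integral_exp_mul_Ioi (by norm_num)]
  norm_num

lemma tendsto_integral_exp_inv_div_mul_add :
    Tendsto (fun s : ℝ => ∫ v in Set.Ioi (0 : ℝ), exp (-1 / (4 * v)) / (v * (s + v)))
      (nhdsWithin 0 (Set.Ioi 0)) (nhds 4) := by
  suffices h : Tendsto (fun s : ℝ => ∫ v in Set.Ioi (0 : ℝ), exp (-1 / (4 * v)) / (v * (s + v)))
      (nhdsWithin 0 (Set.Ioi 0)) (nhds (∫ v in Set.Ioi (0 : ℝ), exp (-1 / (4 * v)) / v ^ 2)) by
    rwa [integral_exp_inv_div_sq] at h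
  refine tendsto_integral_filter_of_dominated_convergence
    (fun v : ℝ => exp (-1 / (4 * v)) / v ^ 2) ?_ ?_ integrableOn_exp_inv_div_sq ?_
  · exact .of_forall fun s => Measurable.aestronglyMeasurable (by fun_prop)
  · filter_upwards [self_mem_nhdsWithin] with s hs
    filter_upwards [ae_restrict_mem measurableSet_Ioi] with v hv
    have hs0 : 0 < s := hs
    have hv0 : 0 < v := hv
    rw [norm_of_nonneg (by positivity)]
    exact div_le_div_of_nonneg_left (exp_pos _).le (by positivity) (by nlinarith)
  · filter_upwards [ae_restrict_mem measurableSet_Ioi] with v hv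
    have hv0 : 0 < v := hv
    have hc : ContinuousAt (fun s : ℝ => exp (-1 / (4 * v)) / (v * (s + v))) 0 := by
      refine ContinuousAt.div (by fun_prop) (by fun_prop) ?_
      rw [zero_add]
      positivity
    have h := hc.tendsto.mono_left (nhdsWithin_le_nhds (s := Set.Ioi 0))
    rwa [zero_add, ← sq] at h

lemma sq_mul_integral_green_half {t x : ℝ} (ht : 0 < t) (hx : 0 < x) :
    x ^ 2 * ∫ τ in Set.Ioi (0 : ℝ),
        exp (-x ^ 2 / (4 * τ)) / (√τ * (t + τ) * √(4 * π * τ)) =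
      (2 * √π)⁻¹ * ∫ v in Set.Ioi (0 : ℝ), exp (-1 / (4 * v)) / (v * (t / x ^ 2 + v)) := by
  have hscale := integral_comp_mul_left_Ioi'
    (fun τ => exp (-x ^ 2 / (4 * τ)) / (√τ * (t + τ) * √(4 * π * τ))) 0 (pow_pos hx 2)
  rw [mul_zero, smul_eq_mul] at hscale
  rw [← hscale, ← integral_const_mul, ← integral_const_mul, ← integral_const_mul]
  refine setIntegral_congr_fun measurableSet_Ioi fun v hv => ?_
  have hv0 : 0 < v := hv
  have hexp : -x ^ 2 / (4 * (x ^ 2 * v)) = -1 / (4 * v) := by field_simp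
  have hsqrt : √(4 * π * (x ^ 2 * v)) = 2 * √π * (x * √v) := by
    rw [sqrt_mul (by positivity), sqrt_mul (by positivity), sqrt_mul (by positivity),
      sqrt_sq hx.le, show (4 : ℝ) = 2 ^ 2 by norm_num, sqrt_sq (by norm_num)]
  have hsqrt' : √(x ^ 2 * v) = x * √v := by rw [sqrt_mul (by positivity), sqrt_sq hx.le]
  have hsq : √v ^ 2 = v := sq_sqrt hv0.le
  have hden : x * √v * (t + x ^ 2 * v) * (2 * √π * (x * √v)) =
      2 * √π * x ^ 4 * (v * (t / x ^ 2 + v)) := by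
    field_simp
    rw [hsq]
  have hpi : 0 < √π := sqrt_pos.2 pi_pos
  have hadd : 0 < t / x ^ 2 + v := by positivity
  rw [hexp, hsqrt, hsqrt', hden]
  field_simp

/-- For fixed `t > 0`, the one-dimensional Green function
`G(x) = (√t/π) ∫_0^∞ e^{-x²/(4τ)} / (√τ (t+τ) √(4πτ)) dτ` satisfies
`G(x) ~ 2√t/(π^{3/2} x²)` as `x → +∞`. -/
theorem green_half_1d_asymp_infty (t : ℝ) (ht : 0 < t) :
    Filter.Tendsto
      (fun x : ℝ =>
        ((Real.sqrt t / Real.pi) *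
          ∫ τ in Set.Ioi (0 : ℝ),
            Real.exp (-x ^ 2 / (4 * τ)) /
              (Real.sqrt τ * (t + τ) * Real.sqrt (4 * Real.pi * τ))) *
          Real.pi ^ (3 / 2 : ℝ) * x ^ 2 / (2 * Real.sqrt t))
      Filter.atTop (nhds 1) := by
  have hlim : Tendsto (fun x : ℝ => t / x ^ 2) atTop (nhdsWithin 0 (Set.Ioi 0)) := by
    refine tendsto_nhdsWithin_iff.2
      ⟨(tendsto_pow_atTop two_ne_zero).const_div_atTop t, ?_⟩
    filter_upwards [eventually_gt_atTop 0] with x hx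
    exact div_pos ht (pow_pos hx 2)
  have hmain := (tendsto_integral_exp_inv_div_mul_add.comp hlim).div_const 4
  rw [div_self four_ne_zero] at hmain
  refine hmain.congr' ?_
  filter_upwards [eventually_gt_atTop 0] with x hx
  have key := sq_mul_integral_green_half ht hx
  have hpi : π ^ (3 / 2 : ℝ) = π * √π := by
    rw [show (3 / 2 : ℝ) = 1 + 1 / 2 by norm_num, rpow_add pi_pos, rpow_one, sqrt_eq_rpow]
  have hpi0 : 0 < √π := sqrt_pos.2 pi_pos
  have ht0 : 0 < √t := sqrt_pos.2 ht
  rw [eq_inv_mul_iff_mul_eq₀ (by positivity)] at key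
  rw [Function.comp_apply, ← key, hpi]
  generalize ∫ τ in Set.Ioi (0 : ℝ),
    exp (-x ^ 2 / (4 * τ)) / (√τ * (t + τ) * √(4 * π * τ)) = I
  field_simp
  ring
end
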